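/- Let Σ be a finite alphabet of size k ≥ 2 and let x ∈ Σ^∞ be computable and normal. Then there exists a computable word y ∈ Σ^∞ such that (a) y is normal, and (b) for every shuffler S over Σ, the output S(x,y) is normal. -/

import Mathlib

open MeasureTheory Filter Finset
open scoped ENNReal ProbabilityTheory

/-- A deterministic shuffler over the alphabet `Fin k`, with state set `Fin S.n`.
`τ q = true` means: read from tape 1 (the `x` tape); `τ q = false` means tape 2. -/
structure Shuffler (k : ℕ) where
  n : ℕ
  q0 : Fin n
  δ : Fin n → Fin k → Fin n
  τ : Fin n → Bool

namespace Shuffler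

variable {k : ℕ}

/-- Configuration after `t` output steps: current state, and the numbers of symbols
consumed from tape 1 and from tape 2. -/
def conf (S : Shuffler k) (x y : ℕ → Fin k) : ℕ → Fin S.n × ℕ × ℕ
  | 0 => (S.q0, 0, 0)
  | t + 1 =>
    match S.conf x y t with
    | (q, a, b) =>
      if S.τ q then (S.δ q (x a), a + 1, b) else (S.δ q (y b), a, b + 1)

/-- The shuffled output word `S(x,y) : ℕ → Fin k`. -/
def out (S : Shuffler k) (x y : ℕ → Fin k) (t : ℕ) : Fin k :=
  match S.conf x y t with
  | (q, a, b) => if S.τ q then x a else y b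

end Shuffler

/-- The length-`n` prefix of an infinite word. -/
def wpre {k : ℕ} (x : ℕ → Fin k) (n : ℕ) : List (Fin k) :=
  List.ofFn (fun i : Fin n => x i)

/-- Overlapping occurrence count of the block `w` inside the finite word `u`. -/
def occ {k : ℕ} (u w : List (Fin k)) : ℕ :=
  ((Finset.range (u.length + 1 - w.length)).filter
    (fun t => (u.drop t).take w.length = w)).card

/-- Aligned (non-overlapping) occurrence count of `w` among the consecutive
`|w|`-blocks of `u`. -/
def alocc {k : ℕ} (u w : List (Fin k)) : ℕ :=
  ((Finset.range (u.length / w.length)).filter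
    (fun j => (u.drop (j * w.length)).take w.length = w)).card

/-- Borel normality of an infinite word over `Fin k`. -/
def IsNormal {k : ℕ} (z : ℕ → Fin k) : Prop :=
  ∀ w : List (Fin k), w ≠ [] →
    Tendsto (fun n => (occ (wpre z n) w : ℝ) / (n : ℝ)) atTop
      (nhds ((1 : ℝ) / (k : ℝ) ^ w.length))

/-- The cylinder determined by a finite word. -/
def cyl {k : ℕ} (u : List (Fin k)) : Set (ℕ → Fin k) :=
  {x | wpre x u.length = u}

/-- `ν` is the i.i.d. uniform product measure on `ℕ → Fin k`:
it gives every cylinder of a length-`n` word measure `k⁻ⁿ`. -/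
def IsUniformProductMeasure {k : ℕ} (ν : Measure (ℕ → Fin k)) : Prop :=
  IsProbabilityMeasure ν ∧ ∀ u : List (Fin k), ν (cyl u) = ((k : ℝ≥0∞))⁻¹ ^ u.length

noncomputable def elln (k n : ℕ) : ℕ := ⌊Real.logb k n / 3⌋₊

noncomputable def epsn (k n : ℕ) : ℝ :=
  2 * Real.sqrt (Real.log n * Real.logb k n / n)

def mnr (n r : ℕ) : ℕ := n / r

/-- The good event `E_S(n, r, w)` (with `r = w.length`). -/
def ESet {k : ℕ} (S : Shuffler k) (n : ℕ) (w : List (Fin k)) :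
    Set ((ℕ → Fin k) × (ℕ → Fin k)) :=
  {p | |(alocc (wpre (S.out p.1 p.2) n) w : ℝ) - (mnr n w.length : ℝ) / (k : ℝ) ^ w.length|
        < epsn k n * (mnr n w.length : ℝ)}

/-- Total conditional bad mass `B_n(u,v)` for the first `n` shufflers of the sequence `S`. -/
noncomputable def Bn {k : ℕ} (μ : Measure ((ℕ → Fin k) × (ℕ → Fin k)))
    (S : ℕ → Shuffler k) (n : ℕ) (u v : List (Fin k)) : ℝ≥0∞ :=
  ∑ i ∈ Finset.Icc 1 n, ∑ r ∈ Finset.Icc 1 (elln k n), ∑ w : Fin r → Fin k,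
    ProbabilityTheory.cond μ (cyl u ×ˢ cyl v) (ESet (S i) n (List.ofFn w))ᶜ

/-- The rolling potential `Φ_L(u,v)` with checkpoints `N_j = (j+m₀)^4`
and activation lengths `A_j = (j+m₀)^2`. -/
noncomputable def Phi {k : ℕ} (μ : Measure ((ℕ → Fin k) × (ℕ → Fin k)))
    (S : ℕ → Shuffler k) (m₀ : ℕ) (L : ℕ) (u v : List (Fin k)) : ℝ≥0∞ :=
  ∑ j ∈ (Finset.Icc 1 L).filter (fun j => (j + m₀) ^ 2 ≤ L ∧ L ≤ (j + m₀) ^ 4),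
    Bn μ S ((j + m₀) ^ 4) u v

/-- `Test(u; m, ε)`: all `m`-blocks of `u` have frequency within `ε` of `k^{-m}`. -/
def TestP {k : ℕ} (u : List (Fin k)) (m : ℕ) (ε : ℝ) : Prop :=
  ∀ w : List (Fin k), w.length = m →
    |(occ u w : ℝ) / (u.length : ℝ) - (1 : ℝ) / (k : ℝ) ^ m| ≤ ε

/-- The test event `E_S(n; m, ε)`. -/
def ETest {k : ℕ} (S : Shuffler k) (n m : ℕ) (ε : ℝ) :
    Set ((ℕ → Fin k) × (ℕ → Fin k)) :=
  {p | TestP (wpre (S.out p.1 p.2) n) m ε}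

/-- The quadratic window slice `H_t(N)(x)`. -/
def Hslice {k : ℕ} (S : ℕ → Shuffler k) (t N : ℕ) (x : ℕ → Fin k) :
    Set (ℕ → Fin k) :=
  ⋂ i ∈ Finset.Icc 1 t, ⋂ ℓ ∈ Finset.Icc 1 t, ⋂ n ∈ Finset.Icc N (N ^ 2),
    {y | (x, y) ∈ ETest (S i) n ℓ ((1 : ℝ) / 2 ^ t)}

/-- A finite encoding of a shuffler, suitable for computability statements. -/
def Shuffler.encode {k : ℕ} (S : Shuffler k) : ℕ × ℕ × List ℕ × List Bool :=
  (S.n, (S.q0 : ℕ),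
    (List.finRange S.n).flatMap (fun q => (List.finRange k).map (fun a => ((S.δ q a : ℕ)))),
    (List.finRange S.n).map S.τ)

/-- Prepend a symbol to an infinite word. -/
def consSeq {k : ℕ} (a : Fin k) (y : ℕ → Fin k) : ℕ → Fin k
  | 0 => a
  | n + 1 => y n

/-- The property of depending only on the first `n` symbols of an infinite word. -/
def DependsOnPrefix {k : ℕ} {β : Type*} (n : ℕ) (g : (ℕ → Fin k) → β) : Prop :=
  ∀ y y', (∀ j < n, y j = y' j) → g y = g y'

/-- The average of `g` over all infinite words that equal `d` from position `n` on. -/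
noncomputable def avg {k : ℕ} (d : Fin k) : ℕ → ((ℕ → Fin k) → ℝ) → ℝ
  | 0, g => g fun _ => d
  | n + 1, g => (∑ a, avg d n fun y => g (consSeq a y)) / k

section avg

variable {k : ℕ} (d : Fin k)

lemma avg_mono {n : ℕ} {g h : (ℕ → Fin k) → ℝ} (H : ∀ y, g y ≤ h y) : avg d n g ≤ avg d n h := by
  induction n generalizing g h with
  | zero => exact H _
  | succ n ih =>
    simp only [avg]
    gcongr with a
    exact ih fun y => H _

lemma avg_const (n : ℕ) (c : ℝ) : avg d n (fun _ => c) = c := by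
  have : (k : ℝ) ≠ 0 := by exact_mod_cast (Fin.pos d).ne'
  induction n with
  | zero => rfl
  | succ n ih => simp [avg, ih]; field_simp

lemma avg_nonneg {n : ℕ} {g : (ℕ → Fin k) → ℝ} (H : ∀ y, 0 ≤ g y) : 0 ≤ avg d n g :=
  (avg_const d n 0).symm.le.trans (avg_mono d H)

lemma avg_const_mul (n : ℕ) (c : ℝ) (g : (ℕ → Fin k) → ℝ) :
    avg d n (fun y => c * g y) = c * avg d n g := by
  induction n generalizing g with
  | zero => rfl
  | succ n ih => simp only [avg, ih, ← Finset.mul_sum, mul_div_assoc]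

lemma DependsOnPrefix.consSeq {β : Type*} {n : ℕ} {g : (ℕ → Fin k) → β}
    (hg : DependsOnPrefix (n + 1) g) (a : Fin k) :
    DependsOnPrefix n (fun y => g (consSeq a y)) := by
  intro y y' h
  apply hg
  rintro (_ | j) hj
  · rfl
  · exact h j (by omega)

lemma DependsOnPrefix.mono {β : Type*} {n m : ℕ} {g : (ℕ → Fin k) → β}
    (hg : DependsOnPrefix n g) (h : n ≤ m) : DependsOnPrefix m g :=
  fun y y' H => hg y y' fun j hj => H j (hj.trans_le h)

lemma avg_succ_of_dependsOnPrefix {n : ℕ} {g : (ℕ → Fin k) → ℝ} (hg : DependsOnPrefix n g) :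
    avg d (n + 1) g = avg d n g := by
  induction n generalizing g with
  | zero =>
    have h : ∀ y, g y = g fun _ => d := fun y => hg _ _ (by simp)
    have hg' : g = fun _ => g fun _ => d := funext h
    rw [hg', avg_const, avg_const]
  | succ n ih =>
    rw [avg, avg]
    congr 1
    exact Finset.sum_congr rfl fun a _ => ih (hg.consSeq a)

lemma avg_of_dependsOnPrefix {n m : ℕ} {g : (ℕ → Fin k) → ℝ} (hg : DependsOnPrefix n g)
    (h : n ≤ m) : avg d m g = avg d n g := by
  induction m, h using Nat.le_induction with
  | base => rfl
  | succ m h ih => rw [avg_succ_of_dependsOnPrefix d (hg.mono h), ih]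

end avg

/-- A deterministic two-tape reader with state set `Q`; `τ q = true` means that state `q`
reads from the first tape. -/
structure TwoTape (k : ℕ) (Q : Type) where
  τ : Q → Bool
  δ : Q → Fin k → Q

namespace TwoTape

variable {k : ℕ} {Q : Type} (A : TwoTape k Q) (x y : ℕ → Fin k)

/-- The symbol read in a configuration (state and positions on the two tapes). -/
def sym (c : Q × ℕ × ℕ) : Fin k := if A.τ c.1 then x c.2.1 else y c.2.2

/-- The successor of a configuration. -/
def step (c : Q × ℕ × ℕ) : Q × ℕ × ℕ :=
  if A.τ c.1 then (A.δ c.1 (x c.2.1), c.2.1 + 1, c.2.2)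
  else (A.δ c.1 (y c.2.2), c.2.1, c.2.2 + 1)

/-- The configuration reached from `c` after `n` steps. -/
def run (c : Q × ℕ × ℕ) (n : ℕ) : Q × ℕ × ℕ := (A.step x y)^[n] c

lemma run_succ (c : Q × ℕ × ℕ) (n : ℕ) : A.run x y c (n + 1) = A.step x y (A.run x y c n) :=
  Function.iterate_succ_apply' _ _ _

lemma run_succ' (c : Q × ℕ × ℕ) (n : ℕ) : A.run x y c (n + 1) = A.run x y (A.step x y c) n :=
  Function.iterate_succ_apply _ _ _

lemma step_fst (c : Q × ℕ × ℕ) : (A.step x y c).1 = A.δ c.1 (A.sym x y c) := by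
  unfold step sym; split <;> rfl

/-- Number of times state `q` is current among the first `n` configurations. -/
def visits [DecidableEq Q] (c : Q × ℕ × ℕ) (q : Q) (n : ℕ) : ℕ :=
  ∑ s ∈ range n, if (A.run x y c s).1 = q then 1 else 0

/-- Number of times `a` is read in state `q` during the first `n` steps. -/
def hits [DecidableEq Q] (c : Q × ℕ × ℕ) (q : Q) (a : Fin k) (n : ℕ) : ℕ :=
  ∑ s ∈ range n, if (A.run x y c s).1 = q ∧ A.sym x y (A.run x y c s) = a then 1 else 0

lemma run_pos_le (c : Q × ℕ × ℕ) (n : ℕ) :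
    (A.run x y c n).2.1 ≤ c.2.1 + n ∧ (A.run x y c n).2.2 ≤ c.2.2 + n := by
  induction n with
  | zero => exact ⟨le_rfl, le_rfl⟩
  | succ n ih =>
    rw [run_succ, step]
    split <;> simp only <;> omega

lemma run_congr {x x' y y' : ℕ → Fin k} {n : ℕ} (q : Q) (hx : ∀ j < n, x j = x' j)
    (hy : ∀ j < n, y j = y' j) {s : ℕ} (hs : s ≤ n) :
    A.run x y (q, 0, 0) s = A.run x' y' (q, 0, 0) s := by
  induction s with
  | zero => rfl
  | succ s ih =>
    have h := A.run_pos_le x' y' (q, 0, 0) s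
    simp only at h
    rw [run_succ, run_succ, ih (by omega), step, step, hx _ (by omega), hy _ (by omega)]

lemma sym_congr {x x' y y' : ℕ → Fin k} {n : ℕ} (q : Q) (hx : ∀ j < n, x j = x' j)
    (hy : ∀ j < n, y j = y' j) {s : ℕ} (hs : s < n) :
    A.sym x y (A.run x y (q, 0, 0) s) = A.sym x' y' (A.run x' y' (q, 0, 0) s) := by
  have h := A.run_pos_le x' y' (q, 0, 0) s
  simp only at h
  rw [A.run_congr q hx hy hs.le, sym, sym, hx _ (by omega), hy _ (by omega)]

lemma visits_congr [DecidableEq Q] {x x' y y' : ℕ → Fin k} {n : ℕ} (q r : Q)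
    (hx : ∀ j < n, x j = x' j) (hy : ∀ j < n, y j = y' j) :
    A.visits x y (q, 0, 0) r n = A.visits x' y' (q, 0, 0) r n := by
  refine Finset.sum_congr rfl fun s hs => ?_
  rw [A.run_congr q hx hy (Finset.mem_range.1 hs).le]

lemma hits_congr [DecidableEq Q] {x x' y y' : ℕ → Fin k} {n : ℕ} (q r : Q) (a : Fin k)
    (hx : ∀ j < n, x j = x' j) (hy : ∀ j < n, y j = y' j) :
    A.hits x y (q, 0, 0) r a n = A.hits x' y' (q, 0, 0) r a n := by
  refine Finset.sum_congr rfl fun s hs => ?_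
  rw [A.sym_congr q hx hy (Finset.mem_range.1 hs), A.run_congr q hx hy (Finset.mem_range.1 hs).le]

/-- The test event: `a` follows `q` noticeably more often than one time in `k`. -/
def Overfull [DecidableEq Q] (q₀ q : Q) (a : Fin k) (e n : ℕ) : Prop :=
  e * A.visits x y (q₀, 0, 0) q n + n < e * (k * A.hits x y (q₀, 0, 0) q a n)

instance [DecidableEq Q] (q₀ q : Q) (a : Fin k) (e n : ℕ) :
    Decidable (A.Overfull x y q₀ q a e n) := by unfold Overfull; infer_instance

lemma overfull_congr [DecidableEq Q] {x x' y y' : ℕ → Fin k} {n : ℕ} (q₀ q : Q) (a : Fin k)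
    (e : ℕ) (hx : ∀ j < n, x j = x' j) (hy : ∀ j < n, y j = y' j) :
    A.Overfull x y q₀ q a e n ↔ A.Overfull x' y' q₀ q a e n := by
  rw [Overfull, Overfull, A.visits_congr q₀ q hx hy, A.hits_congr q₀ q a hx hy]

/-- A morphism of two-tape readers, given by a map on states. -/
lemma run_map {Q' : Type} (B : TwoTape k Q') (e : Q → Q') (hτ : ∀ q, B.τ (e q) = A.τ q)
    (hδ : ∀ q a, B.δ (e q) a = e (A.δ q a)) (c : Q × ℕ × ℕ) (n : ℕ) :
    B.run x y (e c.1, c.2) n = (e (A.run x y c n).1, (A.run x y c n).2) := by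
  induction n with
  | zero => rfl
  | succ n ih =>
    rw [run_succ, run_succ, ih, step, step]
    simp only [hτ, hδ]
    split <;> rfl

lemma sym_map {Q' : Type} (B : TwoTape k Q') (e : Q → Q') (hτ : ∀ q, B.τ (e q) = A.τ q)
    (c : Q × ℕ × ℕ) : B.sym x y (e c.1, c.2) = A.sym x y c := by
  simp [sym, hτ]

lemma overfull_map [DecidableEq Q] {Q' : Type} [DecidableEq Q'] (B : TwoTape k Q') {e : Q → Q'}
    (he : Function.Injective e) (hτ : ∀ q, B.τ (e q) = A.τ q)
    (hδ : ∀ q a, B.δ (e q) a = e (A.δ q a)) (q₀ q : Q) (a : Fin k) (r n : ℕ) :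
    B.Overfull x y (e q₀) (e q) a r n ↔ A.Overfull x y q₀ q a r n := by
  have h := fun s => A.run_map x y B e hτ hδ (q₀, 0, 0) s
  simp only at h
  simp only [Overfull, visits, hits, h, A.sym_map x y B e hτ, he.eq_iff]

end TwoTape

lemma sum_ofFn_succ {k : ℕ} (r : ℕ) (g : List (Fin k) → ℝ) :
    ∑ v : Fin (r + 1) → Fin k, g (List.ofFn v) =
      ∑ a, ∑ v : Fin r → Fin k, g (a :: List.ofFn v) := by
  rw [← Fintype.sum_prod_type', ← (Fin.consEquiv fun _ : Fin (r + 1) => Fin k).sum_comp]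
  refine Finset.sum_congr rfl fun v _ => ?_
  simp [Fin.consEquiv, List.ofFn_succ]

namespace TwoTape

variable {k : ℕ} {Q : Type} (A : TwoTape k Q)

/-- Capital after `n` steps from `c` of a gambler multiplying it by `f q a` whenever `a` is read in
state `q`. -/
noncomputable def capital (f : Q → Fin k → ℝ) (x y : ℕ → Fin k) : ℕ → Q × ℕ × ℕ → ℝ
  | 0, _ => 1
  | n + 1, c => f c.1 (A.sym x y c) * capital f x y n (A.step x y c)

lemma capital_consSeq (f : Q → Fin k → ℝ) (x y : ℕ → Fin k) (α : Fin k) (n : ℕ) (q : Q)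
    (a b : ℕ) : A.capital f x (consSeq α y) n (q, a, b + 1) = A.capital f x y n (q, a, b) := by
  induction n generalizing q a b with
  | zero => rfl
  | succ n ih =>
    simp only [capital, sym, step]
    by_cases h : A.τ q
    · simp [h, ih]
    · simp [h, ih, consSeq]

/-- When both tapes are generated by emitting, in state `q`, the symbol `a` with probability
`p q a`: the probability that the first tape starts with a given word and that this
is visible after `n` steps from a given state. -/
noncomputable def prob (p : Q → Fin k → ℝ) : ℕ → Q → List (Fin k) → ℝ
  | 0, _, u => if u = [] then 1 else 0
  | n + 1, q, u =>
    match u with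
    | [] => 1
    | c :: v =>
      if A.τ q then p q c * prob p n (A.δ q c) v else ∑ a, p q a * prob p n (A.δ q a) (c :: v)

variable {A} {p : Q → Fin k → ℝ}

lemma prob_nil (n : ℕ) (q : Q) : A.prob p n q [] = 1 := by cases n <;> simp [prob]

lemma prob_succ_of_true {q : Q} (h : A.τ q = true) (n : ℕ) (c : Fin k) (u : List (Fin k)) :
    A.prob p (n + 1) q (c :: u) = p q c * A.prob p n (A.δ q c) u := by simp [prob, h]

lemma prob_succ_of_false {q : Q} (h : A.τ q = false) (hp : ∑ a, p q a = 1) (n : ℕ)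
    (u : List (Fin k)) : A.prob p (n + 1) q u = ∑ a, p q a * A.prob p n (A.δ q a) u := by
  cases u with
  | nil => simp [prob_nil, hp]
  | cons c u => simp [prob, h]

lemma prob_nonneg (hp : ∀ q a, 0 ≤ p q a) (n : ℕ) (q : Q) (u : List (Fin k)) :
    0 ≤ A.prob p n q u := by
  induction n generalizing q u with
  | zero => simp only [prob]; split <;> norm_num
  | succ n ih =>
    match u with
    | [] => simp [prob]
    | c :: v =>
      simp only [prob]
      split
      · exact mul_nonneg (hp _ _) (ih _ _)
      · exact Finset.sum_nonneg fun a _ => mul_nonneg (hp _ _) (ih _ _)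

lemma prob_append_le_left (hp : ∀ q a, 0 ≤ p q a) (hp1 : ∀ q, ∑ a, p q a = 1) (n : ℕ) (q : Q)
    (u v : List (Fin k)) : A.prob p n q (u ++ v) ≤ A.prob p n q u := by
  induction n generalizing q u v with
  | zero =>
    cases u with
    | nil => simp only [prob]; split <;> simp
    | cons c u => simp [prob]
  | succ n ih =>
    cases h : A.τ q with
    | true =>
      cases u with
      | nil =>
        rw [List.nil_append, prob_nil]
        cases v with
        | nil => rw [prob_nil]
        | cons c v =>
          rw [prob_succ_of_true h]
          have h1 := ih (A.δ q c) [] v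
          rw [prob_nil, List.nil_append] at h1
          have h2 : p q c ≤ 1 := hp1 q ▸
            Finset.single_le_sum (f := p q) (fun a _ => hp q a) (Finset.mem_univ c)
          exact mul_le_one₀ h2 (prob_nonneg hp _ _ _) h1
      | cons c u =>
        rw [List.cons_append, prob_succ_of_true h, prob_succ_of_true h]
        exact mul_le_mul_of_nonneg_left (ih _ _ _) (hp _ _)
    | false =>
      rw [prob_succ_of_false h (hp1 q), prob_succ_of_false h (hp1 q)]
      exact Finset.sum_le_sum fun a _ => mul_le_mul_of_nonneg_left (ih _ _ _) (hp _ _)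

lemma prob_le_one (hp : ∀ q a, 0 ≤ p q a) (hp1 : ∀ q, ∑ a, p q a = 1) (n : ℕ) (q : Q)
    (u : List (Fin k)) : A.prob p n q u ≤ 1 := by
  simpa [prob_nil] using prob_append_le_left (A := A) hp hp1 n q [] u

lemma prob_mono (hp : ∀ q a, 0 ≤ p q a) (hp1 : ∀ q, ∑ a, p q a = 1) (q : Q) (u : List (Fin k)) :
    Monotone fun n => A.prob p n q u := by
  refine monotone_nat_of_le_succ fun n => ?_
  induction n generalizing q u with
  | zero =>
    cases u with
    | nil => simp [prob_nil]
    | cons c u => exact (by simp [prob] : A.prob p 0 q (c :: u) = 0).trans_le (prob_nonneg hp _ _ _)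
  | succ n ih =>
    cases h : A.τ q with
    | true =>
      cases u with
      | nil => simp [prob_nil]
      | cons c u =>
        rw [prob_succ_of_true h, prob_succ_of_true h]
        exact mul_le_mul_of_nonneg_left (ih _ _) (hp _ _)
    | false =>
      rw [prob_succ_of_false h (hp1 q), prob_succ_of_false h (hp1 q)]
      exact Finset.sum_le_sum fun a _ => mul_le_mul_of_nonneg_left (ih _ _) (hp _ _)

lemma sum_prob_le_one (hp : ∀ q a, 0 ≤ p q a) (hp1 : ∀ q, ∑ a, p q a = 1) (n r : ℕ) (q : Q) :
    ∑ v : Fin r → Fin k, A.prob p n q (List.ofFn v) ≤ 1 := by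
  induction n generalizing q r with
  | zero =>
    cases r with
    | zero => simp [prob]
    | succ r => simp [prob]
  | succ n ih =>
    cases r with
    | zero => simp [prob]
    | succ r =>
      cases h : A.τ q with
      | true =>
        rw [sum_ofFn_succ, ← hp1 q]
        refine Finset.sum_le_sum fun a _ => ?_
        simp only [prob_succ_of_true h, ← Finset.mul_sum]
        exact mul_le_of_le_one_right (hp _ _) (ih _ _)
      | false =>
        simp only [prob_succ_of_false h (hp1 q)]
        rw [Finset.sum_comm, ← hp1 q]
        refine Finset.sum_le_sum fun a _ => ?_
        rw [← Finset.mul_sum]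
        exact mul_le_of_le_one_right (hp _ _) (ih _ _)

lemma prob_append_le [Fintype Q] (hp : ∀ q a, 0 ≤ p q a) (hp1 : ∀ q, ∑ a, p q a = 1) {n N : ℕ}
    (hn : n ≤ N) (q : Q) (u v : List (Fin k)) :
    A.prob p n q (u ++ v) ≤ A.prob p n q u * ∑ s, A.prob p N s v := by
  have hv : 0 ≤ ∑ s, A.prob p N s v := Finset.sum_nonneg fun s _ => prob_nonneg hp _ _ _
  have hnil : ∀ n ≤ N, ∀ q, A.prob p n q v ≤ ∑ s, A.prob p N s v := fun n hn q =>
    (prob_mono hp hp1 q v hn).trans <| Finset.single_le_sum (f := fun s => A.prob p N s v)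
      (fun s _ => prob_nonneg hp _ _ _) (Finset.mem_univ q)
  induction n generalizing q u with
  | zero =>
    cases u with
    | nil => simpa [prob_nil] using hnil 0 hn q
    | cons c u => simp [prob]
  | succ n ih =>
    cases h : A.τ q with
    | true =>
      cases u with
      | nil => simpa [prob_nil] using hnil _ hn q
      | cons c u =>
        rw [List.cons_append, prob_succ_of_true h, prob_succ_of_true h, mul_assoc]
        exact mul_le_mul_of_nonneg_left (ih (by omega) _ _) (hp _ _)
    | false =>
      rw [prob_succ_of_false h (hp1 q), prob_succ_of_false h (hp1 q), Finset.sum_mul]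
      refine Finset.sum_le_sum fun a _ => ?_
      rw [mul_assoc]
      exact mul_le_mul_of_nonneg_left (ih (by omega) _ _) (hp _ _)

/-- The factor of length `j` of an infinite word at position `a`. -/
def _root_.factor (x : ℕ → Fin k) (a j : ℕ) : List (Fin k) := List.ofFn fun i : Fin j => x (a + i)

lemma _root_.factor_succ (x : ℕ → Fin k) (a j : ℕ) :
    factor x a (j + 1) = x a :: factor x (a + 1) j := by
  simp only [factor, List.ofFn_succ, Fin.val_zero, add_zero, Fin.val_succ]
  congr 2
  funext i
  congr 1
  omega

lemma _root_.factor_add (x : ℕ → Fin k) (a i j : ℕ) :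
    factor x a (i + j) = factor x a i ++ factor x (a + i) j := by
  induction i generalizing a with
  | zero => simp [factor]
  | succ i ih =>
    rw [show i + 1 + j = (i + j) + 1 by omega, factor_succ, ih, factor_succ, List.cons_append,
      show a + 1 + i = a + (i + 1) by omega]

lemma avg_capital_le (d : Fin k) (hp : ∀ q a, 0 ≤ p q a) (hp1 : ∀ q, ∑ a, p q a = 1)
    (x : ℕ → Fin k) {n M : ℕ} (hn : n ≤ M) (q : Q) (a : ℕ) :
    avg d M (fun y => A.capital (fun q a => k * p q a) x y n (q, a, 0)) ≤
      ∑ j ∈ range (n + 1), (k : ℝ) ^ j * A.prob p n q (factor x a j) := by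
  have hk : (k : ℝ) ≠ 0 := by exact_mod_cast (Fin.pos d).ne'
  induction n generalizing q a M with
  | zero => simp [capital, avg_const, factor, prob]
  | succ n ih =>
    cases h : A.τ q with
    | true =>
      simp only [capital, sym, step, h, if_true, avg_const_mul]
      rw [Finset.sum_range_succ']
      simp only [factor_succ, prob_succ_of_true h]
      have h1 := mul_le_mul_of_nonneg_left (ih (M := M) (by omega) (A.δ q (x a)) (a + 1))
        (mul_nonneg k.cast_nonneg (hp q (x a)))
      refine h1.trans (le_add_of_le_of_nonneg (le_of_eq ?_) ?_)
      · rw [Finset.mul_sum]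
        exact Finset.sum_congr rfl fun j _ => by ring
      · exact mul_nonneg (by positivity) (prob_nonneg hp _ _ _)
    | false =>
      obtain ⟨M, rfl⟩ : ∃ M', M = M' + 1 := ⟨M - 1, by omega⟩
      rw [Finset.sum_range_succ]
      refine le_add_of_le_of_nonneg ?_ (mul_nonneg (by positivity) (prob_nonneg hp _ _ _))
      simp only [avg, capital, sym, step, h, Bool.false_eq_true, if_false, capital_consSeq,
        avg_const_mul, consSeq, prob_succ_of_false h (hp1 q)]
      simp only [mul_assoc, ← Finset.mul_sum]
      rw [mul_div_cancel_left₀ _ hk]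
      simp only [Finset.mul_sum]
      rw [Finset.sum_comm]
      refine Finset.sum_le_sum fun b _ => ?_
      refine (mul_le_mul_of_nonneg_left (ih (M := M) (by omega) (A.δ q b) a) (hp q b)).trans
        (le_of_eq ?_)
      rw [Finset.mul_sum]
      exact Finset.sum_congr rfl fun j _ => by ring

end TwoTape

lemma occ_wpre {k : ℕ} (x : ℕ → Fin k) (n : ℕ) (w : List (Fin k)) :
    occ (wpre x n) w = #{t ∈ range (n + 1 - w.length) | factor x t w.length = w} := by
  unfold occ
  have hl : (wpre x n).length = n := by simp [wpre]
  rw [hl]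
  congr 1
  refine Finset.filter_congr fun t ht => ?_
  rw [Finset.mem_range] at ht
  have : ((wpre x n).drop t).take w.length = factor x t w.length := by
    apply List.ext_getElem
    · simp [wpre, factor]; omega
    · intro i h1 h2
      simp [wpre, factor]
  rw [this]

lemma IsNormal.eventually_card_factor_le {k : ℕ} (hk : 0 < k) {x : ℕ → Fin k} (hx : IsNormal x)
    {r : ℕ} (hr : 0 < r) (v : Fin r → Fin k) :
    ∀ᶠ T : ℕ in atTop,
      (#{t ∈ range T | (fun i : Fin r => x (t + i)) = v} : ℝ) ≤ 2 / (k : ℝ) ^ r * T := by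
  have h0 : (0 : ℝ) < 1 / (k : ℝ) ^ r := by positivity
  have h := hx (List.ofFn v) (by rw [Ne, List.ofFn_eq_nil_iff]; omega)
  rw [List.length_ofFn] at h
  have h1 : ∀ᶠ n : ℕ in atTop, (occ (wpre x n) (List.ofFn v) : ℝ) / n ≤ 3 / 2 * (1 / (k : ℝ) ^ r) :=
    (h.eventually_lt_const (by linarith)).mono fun n hn => hn.le
  have h2 : Tendsto (fun T : ℕ => T + r - 1) atTop atTop :=
    tendsto_atTop_mono (fun T => by rw [id]; omega) tendsto_id
  filter_upwards [h2.eventually h1, eventually_ge_atTop (3 * r)] with T hT hT'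
  rw [occ_wpre, List.length_ofFn, show T + r - 1 + 1 - r = T by omega,
    div_le_iff₀ (by norm_cast; omega)] at hT
  have heq : {t ∈ range T | factor x t r = List.ofFn v} =
      {t ∈ range T | (fun i : Fin r => x (t + i)) = v} :=
    Finset.filter_congr fun t _ => List.ofFn_injective.eq_iff
  rw [heq] at hT
  refine hT.trans ?_
  have h3 : ((T + r - 1 : ℕ) : ℝ) ≤ 4 / 3 * T := by
    have : (3 * (T + r - 1) : ℕ) ≤ 4 * T := by omega
    have : (3 * (T + r - 1 : ℕ) : ℝ) ≤ 4 * T := by exact_mod_cast this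
    linarith
  calc 3 / 2 * (1 / (k : ℝ) ^ r) * ((T + r - 1 : ℕ) : ℝ)
      ≤ 3 / 2 * (1 / (k : ℝ) ^ r) * (4 / 3 * T) := by gcongr
    _ = _ := by ring

lemma prod_le_pow_of_sum_le {B : ℝ} (hB : 0 < B) {T : ℕ} {c : ℕ → ℝ} (hc : ∀ t, 0 ≤ c t)
    (h : ∑ t ∈ range T, c t ≤ B * T) : ∏ t ∈ range T, c t ≤ B ^ T := by
  have h1 : ∀ t ∈ range T, c t ≤ B * Real.exp (c t / B - 1) := fun t _ => by
    have := Real.add_one_le_exp (c t / B - 1)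
    calc c t = B * (c t / B - 1 + 1) := by field_simp; ring
      _ ≤ _ := by gcongr
  refine (Finset.prod_le_prod (fun t _ => hc t) h1).trans ?_
  rw [Finset.prod_mul_distrib, Finset.prod_const, Finset.card_range, ← Real.exp_sum]
  refine mul_le_of_le_one_right (by positivity) (Real.exp_le_one_iff.2 ?_)
  rw [Finset.sum_sub_distrib, ← Finset.sum_div, Finset.sum_const, Finset.card_range, nsmul_eq_mul,
    mul_one, sub_nonpos, div_le_iff₀ hB]
  linarith

/-- If `b` loses at least a factor `A T` between times `T` and `T + r`, then the decay
accumulated over all residues modulo `r` is the product of all the `A t`. -/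
lemma pow_le_prod_of_le_mul {b A : ℕ → ℝ} {r : ℕ} (hr : 0 < r) (hb : ∀ t, 0 ≤ b t) (hA : ∀ t, 0 ≤ A t)
    (hb1 : b 0 ≤ 1) (hanti : Antitone b) (h : ∀ T, b (T + r) ≤ b T * A T) (T : ℕ) :
    b (T + r) ^ r ≤ ∏ t ∈ range T, A t := by
  have key : ∏ t ∈ range r, b (T + t) ≤ ∏ t ∈ range T, A t := by
    induction T with
    | zero =>
      rw [Finset.prod_range_zero]
      exact Finset.prod_le_one (fun t _ => hb _) fun t _ => (hanti (Nat.zero_le _)).trans hb1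
    | succ T ih =>
      rw [Finset.prod_range_succ]
      refine le_trans ?_ (mul_le_mul_of_nonneg_right ih (hA T))
      obtain ⟨r, rfl⟩ : ∃ r', r = r' + 1 := ⟨r - 1, by omega⟩
      rw [Finset.prod_range_succ, Finset.prod_range_succ' _ r, add_zero, mul_assoc]
      have h1 : ∀ t, T + 1 + t = T + (t + 1) := fun t => by omega
      simp only [h1]
      exact mul_le_mul_of_nonneg_left (h T) (Finset.prod_nonneg fun t _ => hb _)
  refine le_trans ?_ key
  calc b (T + r) ^ r = ∏ _t ∈ range r, b (T + r) := by simp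
    _ ≤ _ := Finset.prod_le_prod (fun t _ => hb _) fun t ht =>
      hanti (by have := Finset.mem_range.1 ht; omega)

namespace TwoTape

variable {k : ℕ} {Q : Type} {A : TwoTape k Q} {p : Q → Fin k → ℝ}

lemma sum_prob_factor_le [Fintype Q] (hp : ∀ q a, 0 ≤ p q a) (hp1 : ∀ q, ∑ a, p q a = 1)
    (hk : 0 < k) {x : ℕ → Fin k} {r T : ℕ}
    (hT : ∀ v : Fin r → Fin k,
      (#{t ∈ range T | (fun i : Fin r => x (t + i)) = v} : ℝ) ≤ 2 / (k : ℝ) ^ r * T) (N : ℕ) :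
    ∑ t ∈ range T, (k : ℝ) ^ r * ∑ s, A.prob p N s (factor x t r) ≤
      2 * Fintype.card Q * T := by
  rw [← Finset.sum_fiberwise _ (fun t => fun i : Fin r => x (t + i))]
  have h1 : ∀ v : Fin r → Fin k,
      ∑ t ∈ range T with (fun i : Fin r => x (t + i)) = v,
        (k : ℝ) ^ r * ∑ s, A.prob p N s (factor x t r) ≤
      2 * T * ∑ s, A.prob p N s (List.ofFn v) := fun v => by
    have h2 : ∀ t ∈ (range T).filter (fun t => (fun i : Fin r => x (t + i)) = v),
        (k : ℝ) ^ r * ∑ s, A.prob p N s (factor x t r) =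
          (k : ℝ) ^ r * ∑ s, A.prob p N s (List.ofFn v) := fun t ht => by
      rw [factor, (Finset.mem_filter.1 ht).2]
    rw [Finset.sum_congr rfl h2, Finset.sum_const, nsmul_eq_mul]
    have h3 : 0 ≤ (k : ℝ) ^ r * ∑ s, A.prob p N s (List.ofFn v) :=
      mul_nonneg (by positivity) (Finset.sum_nonneg fun s _ => prob_nonneg hp _ _ _)
    refine (mul_le_mul_of_nonneg_right (hT v) h3).trans (le_of_eq ?_)
    field_simp
  refine (Finset.sum_le_sum fun v _ => h1 v).trans ?_
  rw [← Finset.mul_sum, Finset.sum_comm]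
  have h4 : ∑ s, ∑ v : Fin r → Fin k, A.prob p N s (List.ofFn v) ≤ Fintype.card Q := by
    refine (Finset.sum_le_sum fun s _ => sum_prob_le_one hp hp1 N r s).trans ?_
    simp
  calc _ ≤ 2 * (T : ℝ) * Fintype.card Q := by gcongr
    _ = _ := by ring

/-- Along a normal word, the expected capital grows subexponentially. -/
lemma eventually_avg_capital_le [Fintype Q] (d : Fin k) (hp : ∀ q a, 0 ≤ p q a)
    (hp1 : ∀ q, ∑ a, p q a = 1) {x : ℕ → Fin k} (hx : IsNormal x) (q : Q) {ρ : ℝ} (hρ : 1 < ρ) :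
    ∀ᶠ n in atTop,
      avg d n (fun y => A.capital (fun q a => k * p q a) x y n (q, 0, 0)) ≤ ρ ^ n := by
  have hk : 0 < k := Fin.pos d
  have hk1 : (1 : ℝ) ≤ k := by exact_mod_cast hk
  set B : ℝ := 2 * Fintype.card Q with hB
  have hQ : (1 : ℝ) ≤ Fintype.card Q := by exact_mod_cast Fintype.card_pos_iff.2 ⟨q⟩
  have hB1 : 1 ≤ B := by linarith
  set σ := √ρ with hσ
  have hσ1 : 1 < σ := Real.lt_sqrt_of_sq_lt (by simpa using hρ)
  have hσσ : σ * σ = ρ := Real.mul_self_sqrt (by linarith)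
  obtain ⟨r, hr⟩ := pow_unbounded_of_one_lt B hσ1
  have hr0 : 0 < r := by
    rcases Nat.eq_zero_or_pos r with rfl | h
    · simp at hr; linarith
    · exact h
  obtain ⟨T₀, hT₀⟩ := eventually_atTop.1 <|
    eventually_all.2 fun v : Fin r → Fin k => hx.eventually_card_factor_le hk hr0 v
  have bound : ∀ n, ∀ j ≤ n,
      (k : ℝ) ^ j * A.prob p n q (factor x 0 j) ≤ (k : ℝ) ^ (T₀ + r) * σ ^ n := by
    intro n j hj
    rcases lt_or_ge j (T₀ + r) with h | h
    · calc (k : ℝ) ^ j * A.prob p n q (factor x 0 j)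
          ≤ (k : ℝ) ^ j * 1 := by gcongr; exact prob_le_one hp hp1 _ _ _
        _ ≤ (k : ℝ) ^ (T₀ + r) * σ ^ n := by
          gcongr
          exact one_le_pow₀ hσ1.le
    · obtain ⟨T, rfl⟩ : ∃ T, j = T + r := ⟨j - r, by omega⟩
      have h1 : A.prob p n q (factor x 0 (T + r)) ^ r ≤
          ∏ t ∈ range T, ∑ s, A.prob p n s (factor x t r) := by
        refine pow_le_prod_of_le_mul hr0 (b := fun t => A.prob p n q (factor x 0 t))
          (A := fun t => ∑ s, A.prob p n s (factor x t r)) (fun t => prob_nonneg hp _ _ _)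
          (fun t => Finset.sum_nonneg fun s _ => prob_nonneg hp _ _ _) (prob_le_one hp hp1 _ _ _)
          ?_ ?_ T
        · refine antitone_nat_of_succ_le fun t => ?_
          rw [factor_add]
          exact prob_append_le_left hp hp1 _ _ _ _
        · intro T
          simp only [factor_add, zero_add]
          exact prob_append_le hp hp1 le_rfl _ _ _
      have h2 : ∏ t ∈ range T, ((k : ℝ) ^ r * ∑ s, A.prob p n s (factor x t r)) ≤ B ^ T :=
        prod_le_pow_of_sum_le (by linarith)
          (fun t => mul_nonneg (by positivity)
            (Finset.sum_nonneg fun s _ => prob_nonneg hp _ _ _))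
          (sum_prob_factor_le hp hp1 hk (hT₀ T (by omega)) n)
      rw [Finset.prod_mul_distrib, Finset.prod_const, Finset.card_range] at h2
      have h3 : ((k : ℝ) ^ (T + r) * A.prob p n q (factor x 0 (T + r))) ^ r ≤
          ((k : ℝ) ^ (T₀ + r) * σ ^ n) ^ r := by
        calc ((k : ℝ) ^ (T + r) * A.prob p n q (factor x 0 (T + r))) ^ r
            = ((k : ℝ) ^ r) ^ r * (((k : ℝ) ^ r) ^ T * A.prob p n q (factor x 0 (T + r)) ^ r) := by
              ring
          _ ≤ ((k : ℝ) ^ r) ^ r * (((k : ℝ) ^ r) ^ T *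
                ∏ t ∈ range T, ∑ s, A.prob p n s (factor x t r)) := by gcongr
          _ ≤ ((k : ℝ) ^ r) ^ r * B ^ T := by gcongr
          _ ≤ ((k : ℝ) ^ (T₀ + r)) ^ r * (σ ^ r) ^ n := by
              gcongr ?_ * ?_
              · gcongr
                omega
              · calc B ^ T ≤ B ^ n := by gcongr; omega
                  _ ≤ _ := by gcongr
          _ = _ := by ring
      exact le_of_pow_le_pow_left₀ hr0.ne' (by positivity) h3
  have hlim : Tendsto (fun n : ℕ => ((n : ℝ) + 1) * (1 / σ) ^ n) atTop (nhds 0) := by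
    have h1 : |1 / σ| < 1 := by
      rw [abs_of_pos (by positivity), div_lt_one (by positivity)]; exact hσ1
    have h2 := tendsto_pow_const_mul_const_pow_of_abs_lt_one 1 h1
    have h3 := tendsto_pow_atTop_nhds_zero_of_abs_lt_one h1
    simpa [add_mul] using h2.add h3
  have hc : (0 : ℝ) < 1 / (k : ℝ) ^ (T₀ + r) := by positivity
  filter_upwards [hlim.eventually_lt_const hc] with n hn
  refine (avg_capital_le d hp hp1 x le_rfl q 0).trans ?_
  refine (Finset.sum_le_sum fun j hj => bound n j (by
    have := Finset.mem_range.1 hj; omega)).trans ?_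
  rw [Finset.sum_const, Finset.card_range, nsmul_eq_mul]
  have h1 : ((n : ℝ) + 1) * (k : ℝ) ^ (T₀ + r) ≤ σ ^ n := by
    rw [one_div_pow, mul_one_div, div_lt_div_iff₀ (by positivity) (by positivity)] at hn
    linarith
  calc ((n + 1 : ℕ) : ℝ) * ((k : ℝ) ^ (T₀ + r) * σ ^ n)
      = ((n : ℝ) + 1) * (k : ℝ) ^ (T₀ + r) * σ ^ n := by push_cast; ring
    _ ≤ σ ^ n * σ ^ n := by gcongr
    _ = ρ ^ n := by rw [← mul_pow, hσσ]

end TwoTape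

namespace TwoTape

variable {k : ℕ} {Q : Type} (A : TwoTape k Q)

section

variable [DecidableEq Q] (x y : ℕ → Fin k)

lemma visits_succ' (c : Q × ℕ × ℕ) (q : Q) (n : ℕ) :
    A.visits x y c q (n + 1) = A.visits x y (A.step x y c) q n + if c.1 = q then 1 else 0 := by
  rw [visits, Finset.sum_range_succ']
  simp only [run_succ']
  rfl

lemma hits_succ' (c : Q × ℕ × ℕ) (q : Q) (a : Fin k) (n : ℕ) :
    A.hits x y c q a (n + 1) =
      A.hits x y (A.step x y c) q a n + if c.1 = q ∧ A.sym x y c = a then 1 else 0 := by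
  rw [hits, Finset.sum_range_succ']
  simp only [run_succ']
  rfl

lemma exp_le_capital {f : Q → Fin k → ℝ} {q : Q} {a : Fin k} {l b : ℝ}
    (hf : ∀ s c, Real.exp (l * (k * (if s = q ∧ c = a then 1 else 0) -
      (if s = q then 1 else 0)) - b) ≤ f s c) (n : ℕ) (c : Q × ℕ × ℕ) :
    Real.exp (l * (k * A.hits x y c q a n - A.visits x y c q n) - b * n) ≤
      A.capital f x y n c := by
  induction n generalizing c with
  | zero => simp [visits, hits, capital]
  | succ n ih =>
    rw [capital, visits_succ', hits_succ']
    refine le_trans (le_of_eq ?_) (mul_le_mul (hf c.1 (A.sym x y c)) (ih _) (Real.exp_pos _).le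
      ((Real.exp_pos _).le.trans (hf _ _)))
    rw [← Real.exp_add]
    push_cast
    congr 1
    ring

end

lemma exp_le_one_add {u m : ℝ} (h1 : -(1 / 2) ≤ u) (h2 : u ^ 2 ≤ m) :
    Real.exp (u - 2 * m) ≤ 1 + u := by
  have hu : 0 < 1 + u := by linarith
  rw [← Real.le_log_iff_exp_le hu]
  refine le_trans ?_ (Real.one_sub_inv_le_log_of_pos hu)
  have : 1 - (1 + u)⁻¹ = u - u ^ 2 / (1 + u) := by field_simp; ring
  rw [this]
  have : u ^ 2 / (1 + u) ≤ 2 * m := by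
    rw [div_le_iff₀ hu]
    nlinarith [sq_nonneg u]
  linarith

/-- Along a normal word, overfull events are exponentially unlikely. -/
theorem exists_eventually_avg_overfull_le [Fintype Q] [DecidableEq Q] (d : Fin k)
    {x : ℕ → Fin k} (hx : IsNormal x) (q₀ q : Q) (a : Fin k) {e : ℕ} (he : 0 < e) :
    ∃ ρ : ℝ, 0 < ρ ∧ ρ < 1 ∧ ∀ᶠ n in atTop,
      avg d n (fun y => if A.Overfull x y q₀ q a e n then 1 else 0) ≤ ρ ^ n := by
  have hk0 : (1 : ℝ) ≤ k := by exact_mod_cast Fin.pos d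
  have he0 : (1 : ℝ) ≤ e := by exact_mod_cast he
  set l : ℝ := 1 / (4 * e * k ^ 2) with hl
  have hl0 : 0 < l := by positivity
  have hlk : l * k ≤ 1 / 4 := by
    rw [hl, div_mul_eq_mul_div, div_le_iff₀ (by positivity)]
    nlinarith [mul_le_mul he0 hk0 zero_le_one (by linarith : (0 : ℝ) ≤ e)]
  have hll : l ≤ 1 / 4 := (le_mul_of_one_le_right hl0.le hk0).trans hlk
  set p : Q → Fin k → ℝ := fun s b =>
    (1 + l * (k * (if s = q ∧ b = a then 1 else 0) - (if s = q then 1 else 0))) / k with hpdef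
  have hu : ∀ s b, -(1 / 2) ≤ l * (k * (if s = q ∧ b = a then (1 : ℝ) else 0) -
      (if s = q then 1 else 0)) ∧ (l * (k * (if s = q ∧ b = a then (1 : ℝ) else 0) -
      (if s = q then 1 else 0))) ^ 2 ≤ l ^ 2 * k ^ 2 := fun s b => by
    by_cases h1 : s = q <;> by_cases h2 : b = a <;> simp only [h1, h2, and_self, if_true, if_false,
      true_and, false_and, mul_one, mul_zero, sub_zero, zero_sub]
    · exact ⟨by nlinarith, by rw [mul_pow]; gcongr; linarith⟩
    · exact ⟨by nlinarith, by
        rw [mul_pow]; exact mul_le_mul_of_nonneg_left (by nlinarith) (sq_nonneg l)⟩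
    · exact ⟨by norm_num, by rw [zero_pow two_ne_zero]; positivity⟩
    · exact ⟨by norm_num, by rw [zero_pow two_ne_zero]; positivity⟩
  have hp : ∀ s b, 0 ≤ p s b := fun s b => div_nonneg (by linarith [(hu s b).1]) (by linarith)
  have hp1 : ∀ s, ∑ b, p s b = 1 := fun s => by
    simp only [hpdef, ← Finset.sum_div]
    rw [div_eq_one_iff_eq (by positivity)]
    by_cases h : s = q <;> simp [h, Finset.sum_add_distrib, ← Finset.mul_sum]
  have hf : ∀ s b, Real.exp (l * (k * (if s = q ∧ b = a then 1 else 0) -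
      (if s = q then 1 else 0)) - 2 * (l ^ 2 * k ^ 2)) ≤ k * p s b := fun s b => by
    rw [hpdef, mul_div_cancel₀ _ (by positivity)]
    exact exp_le_one_add (hu s b).1 (hu s b).2
  set c : ℝ := l / (2 * e) with hc
  have hc0 : 0 < c := by positivity
  refine ⟨Real.exp (-(c / 2)), Real.exp_pos _, Real.exp_lt_one_iff.2 (by linarith), ?_⟩
  filter_upwards [eventually_avg_capital_le (A := A) d hp hp1 hx q₀
    (Real.one_lt_exp_iff.2 (half_pos hc0))] with n hn
  have h1 : ∀ y, (if A.Overfull x y q₀ q a e n then (1 : ℝ) else 0) ≤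
      Real.exp (-(c * n)) * A.capital (fun q a => k * p q a) x y n (q₀, 0, 0) := fun y => by
    have h2 := A.exp_le_capital x y hf n (q₀, 0, 0)
    split_ifs with h
    · have h3 : (e : ℝ) * A.visits x y (q₀, 0, 0) q n + n <
          e * (k * A.hits x y (q₀, 0, 0) q a n) := by exact_mod_cast h
      have h4 : c * n ≤ l * (k * A.hits x y (q₀, 0, 0) q a n - A.visits x y (q₀, 0, 0) q n) -
          2 * (l ^ 2 * k ^ 2) * n := by
        have h5 : l * (n / e) ≤
            l * (k * A.hits x y (q₀, 0, 0) q a n - A.visits x y (q₀, 0, 0) q n) := by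
          refine mul_le_mul_of_nonneg_left ?_ hl0.le
          rw [div_le_iff₀ (by positivity)]
          linarith
        have h6 : c * n = l * (n / e) - 2 * (l ^ 2 * k ^ 2) * n := by
          rw [hc, hl]
          field_simp
          ring
        linarith
      calc (1 : ℝ) = Real.exp (-(c * n)) * Real.exp (c * n) := by rw [← Real.exp_add]; simp
        _ ≤ _ := mul_le_mul_of_nonneg_left ((Real.exp_le_exp.2 h4).trans h2) (Real.exp_pos _).le
    · exact mul_nonneg (Real.exp_pos _).le ((Real.exp_pos _).le.trans h2)
  refine (avg_mono d h1).trans ?_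
  rw [avg_const_mul]
  refine (mul_le_mul_of_nonneg_left hn (Real.exp_pos _).le).trans (le_of_eq ?_)
  rw [← Real.exp_nat_mul, ← Real.exp_nat_mul, ← Real.exp_add]
  congr 1
  ring

end TwoTape

section Words

variable {k : ℕ}

/-- The infinite word that continues the list `u` with the constant symbol `d`. -/
def tape (d : Fin k) (u : List (Fin k)) : ℕ → Fin k := fun j => u.getD j d

/-- Prepend a finite word to an infinite one. -/
def prepend (v : List (Fin k)) (y : ℕ → Fin k) : ℕ → Fin k := v.foldr consSeq y

/-- The list of all words of length `n`. -/
def words (k : ℕ) : ℕ → List (List (Fin k))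
  | 0 => [[]]
  | n + 1 => (List.finRange k).flatMap fun a => (words k n).map (a :: ·)

lemma tape_cons (d a : Fin k) (u : List (Fin k)) : tape d (a :: u) = consSeq a (tape d u) := by
  funext j
  cases j <;> simp [tape, consSeq]

lemma tape_append (d : Fin k) (v u : List (Fin k)) : tape d (v ++ u) = prepend v (tape d u) := by
  induction v with
  | nil => rfl
  | cons a v ih => rw [List.cons_append, tape_cons, ih]; rfl

lemma prepend_append_singleton (v : List (Fin k)) (a : Fin k) (y : ℕ → Fin k) :
    prepend (v ++ [a]) y = prepend v (consSeq a y) := by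
  simp [prepend]

lemma prepend_apply_of_lt (d : Fin k) {v : List (Fin k)} {j : ℕ} (hj : j < v.length)
    (y : ℕ → Fin k) : prepend v y j = v.getD j d := by
  induction v generalizing j with
  | nil => simp at hj
  | cons a v ih =>
    cases j with
    | zero => simp [prepend, consSeq]
    | succ j => simpa [prepend, consSeq] using ih (by simpa using hj)

lemma DependsOnPrefix.prepend {β : Type*} {n : ℕ} {g : (ℕ → Fin k) → β}
    (hg : DependsOnPrefix n g) (v : List (Fin k)) :
    DependsOnPrefix n fun y => g (prepend v y) := by
  induction v generalizing g with
  | nil => exact hg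
  | cons a v ih => exact ih ((hg.mono n.le_succ).consSeq a)

lemma tape_wpre (d : Fin k) (x : ℕ → Fin k) {n j : ℕ} (hj : j < n) :
    tape d (wpre x n) j = x j := by
  simp [tape, wpre, hj]

lemma sum_words (d : Fin k) (n : ℕ) (g : (ℕ → Fin k) → ℕ) :
    ((((words k n).map fun u => g (tape d u)).sum : ℕ) : ℝ) = k ^ n * avg d n fun y => (g y : ℝ) := by
  have hk : (k : ℝ) ≠ 0 := by exact_mod_cast (Fin.pos d).ne'
  induction n generalizing g with
  | zero => simp [words, avg]; rfl
  | succ n ih =>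
    have h : ∀ a : Fin k, (((words k n).map fun u => g (tape d (a :: u))).sum : ℝ) =
        k ^ n * avg d n fun y => (g (consSeq a y) : ℝ) := fun a => by
      simp only [tape_cons]
      exact ih fun y => g (consSeq a y)
    simp only [words, List.map_flatMap, List.map_map, Function.comp_def]
    rw [List.flatMap, List.sum_flatten, List.map_map, ← List.ofFn_eq_map, List.sum_ofFn]
    push_cast
    simp only [Function.comp_def, h, avg, ← Finset.mul_sum]
    field_simp
    ring

/-- The average of `g` over continuations of `v`. -/
noncomputable def condAvg (d : Fin k) (n : ℕ) (g : (ℕ → Fin k) → ℝ) (v : List (Fin k)) : ℝ :=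
  avg d n fun y => g (prepend v y)

lemma sum_condAvg (d : Fin k) {n : ℕ} {g : (ℕ → Fin k) → ℝ} (hg : DependsOnPrefix n g)
    (v : List (Fin k)) : ∑ a, condAvg d n g (v ++ [a]) = k * condAvg d n g v := by
  have hk : (k : ℝ) ≠ 0 := by exact_mod_cast (Fin.pos d).ne'
  rw [condAvg, ← avg_succ_of_dependsOnPrefix d (hg.prepend v), avg]
  simp only [condAvg, prepend_append_singleton]
  field_simp

lemma condAvg_nonneg (d : Fin k) {n : ℕ} {g : (ℕ → Fin k) → ℝ} (h : ∀ y, 0 ≤ g y)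
    (v : List (Fin k)) : 0 ≤ condAvg d n g v := avg_nonneg d fun _ => h _

lemma condAvg_le (d : Fin k) {n : ℕ} {g : (ℕ → Fin k) → ℝ} (hg : DependsOnPrefix n g)
    (h : ∀ y, 0 ≤ g y) (v : List (Fin k)) :
    condAvg d n g v ≤ k ^ v.length * condAvg d n g [] := by
  induction v using List.reverseRecOn with
  | nil => simp
  | append_singleton v a ih =>
    have h1 := Finset.single_le_sum (f := fun a => condAvg d n g (v ++ [a]))
      (fun a _ => condAvg_nonneg d h _) (Finset.mem_univ a)
    rw [sum_condAvg d hg v] at h1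
    refine h1.trans ?_
    rw [List.length_append, List.length_singleton, pow_succ', mul_assoc]
    gcongr

end Words

section Derandomization

variable {k : ℕ} (d : Fin k) (B : ℕ → ℕ → (ℕ → Fin k) → (ℕ → Fin k) → Bool) (x : ℕ → Fin k)

/-- Number of words `u` of length `m` such that `v ++ u` triggers the test `B i n`. -/
def testCount (i n m : ℕ) (v : List (Fin k)) : ℕ :=
  ((words k m).map fun u => if B i n x (tape d (v ++ u)) then 1 else 0).sum

/-- Whether the test `B i n` is rare enough to be taken into account. -/
def IsActive (i n : ℕ) : Prop :=
  testCount d B x i n n [] * ((n + 1) * ((n + 2) * (n + 3)) * k ^ n.sqrt) ≤ k ^ n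

instance (i n : ℕ) : Decidable (IsActive d B x i n) := by unfold IsActive; infer_instance

/-- Total number of triggered active tests over all continuations of `v`. -/
def potential (l : ℕ) (v : List (Fin k)) : ℕ :=
  ∑ n ∈ range ((l + 1) ^ 2), ∑ i ∈ range (n + 1),
    if IsActive d B x i n then testCount d B x i n ((l + 1) ^ 2) v else 0

/-- A next symbol that does not increase the potential. -/
def nextSymbol (l : ℕ) (v : List (Fin k)) : Fin k :=
  (List.finRange k).getD ((List.finRange k).findIdx fun a =>
    decide (potential d B x l (v ++ [a]) ≤ potential d B x l v)) d

/-- The length-`l` prefix of the word avoiding the active tests. -/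
def avoidPrefix : ℕ → List (Fin k)
  | 0 => []
  | l + 1 => avoidPrefix l ++ [nextSymbol d B x l (avoidPrefix l)]

/-- A word avoiding all active tests. -/
def avoid (j : ℕ) : Fin k := (avoidPrefix d B x (j + 1)).getD j d

/-- The potential as a sum of conditional probabilities. -/
noncomputable def realPotential (l : ℕ) (v : List (Fin k)) : ℝ :=
  ∑ n ∈ range ((l + 1) ^ 2), ∑ i ∈ range (n + 1),
    if IsActive d B x i n then condAvg d n (fun y => if B i n x y then 1 else 0) v else 0

variable {d B x}

lemma length_avoidPrefix (l : ℕ) : (avoidPrefix d B x l).length = l := by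
  induction l with
  | zero => rfl
  | succ l ih => simp [avoidPrefix, ih]

lemma avoidPrefix_getD {n j : ℕ} (hj : j < n) :
    (avoidPrefix d B x n).getD j d = avoid d B x j := by
  induction n, (Nat.succ_le_of_lt hj) using Nat.le_induction with
  | base => rfl
  | succ n hn ih =>
    rw [← ih hn, avoidPrefix, List.getD_append _ _ _ _ (by rwa [length_avoidPrefix])]

/-- The tests of length `n` depend only on the first `n` symbols of both words. -/
def IsPrefixTest {k : ℕ} (B : ℕ → ℕ → (ℕ → Fin k) → (ℕ → Fin k) → Bool) : Prop :=
  ∀ i n x x' y y', (∀ j < n, x j = x' j) → (∀ j < n, y j = y' j) → B i n x y = B i n x' y'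

lemma dependsOnPrefix_test (hB : IsPrefixTest B) (i n : ℕ) :
    DependsOnPrefix n fun y => if B i n x y then (1 : ℝ) else 0 := fun y y' h => by
  simp only [hB i n x x y y' (fun _ _ => rfl) h]

lemma testCount_eq (hB : IsPrefixTest B) (i : ℕ) {n m : ℕ} (h : n ≤ m) (v : List (Fin k)) :
    (testCount d B x i n m v : ℝ) =
      k ^ m * condAvg d n (fun y => if B i n x y then 1 else 0) v := by
  have H := (dependsOnPrefix_test (x := x) hB i n).prepend v
  rw [condAvg, ← avg_of_dependsOnPrefix d H h]
  simp only [testCount, tape_append]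
  rw [sum_words d m fun y => if B i n x (prepend v y) then 1 else 0]
  push_cast
  rfl

lemma potential_eq (hB : IsPrefixTest B) (l : ℕ) (v : List (Fin k)) :
    (potential d B x l v : ℝ) = k ^ ((l + 1) ^ 2) * realPotential d B x l v := by
  rw [potential, realPotential, Nat.cast_sum, Finset.mul_sum]
  refine Finset.sum_congr rfl fun n hn => ?_
  rw [Nat.cast_sum, Finset.mul_sum]
  refine Finset.sum_congr rfl fun i _ => ?_
  split_ifs
  · exact testCount_eq hB i (Finset.mem_range.1 hn).le v
  · simp

lemma sum_realPotential (hB : IsPrefixTest B) (l : ℕ) (v : List (Fin k)) :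
    ∑ a, realPotential d B x l (v ++ [a]) = k * realPotential d B x l v := by
  simp only [realPotential]
  rw [Finset.sum_comm, Finset.mul_sum]
  refine Finset.sum_congr rfl fun n _ => ?_
  rw [Finset.sum_comm, Finset.mul_sum]
  refine Finset.sum_congr rfl fun i _ => ?_
  split_ifs
  · exact sum_condAvg d (dependsOnPrefix_test hB i n) v
  · simp

lemma exists_potential_le (hB : IsPrefixTest B) (l : ℕ) (v : List (Fin k)) :
    ∃ a, potential d B x l (v ++ [a]) ≤ potential d B x l v := by
  have : Nonempty (Fin k) := ⟨d⟩
  have h : ∑ a, (potential d B x l (v ++ [a]) : ℝ) ≤ ∑ _a : Fin k, (potential d B x l v : ℝ) := by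
    simp only [potential_eq hB, ← Finset.mul_sum, sum_realPotential hB]
    simp only [Finset.sum_const, Finset.card_univ, Fintype.card_fin, nsmul_eq_mul]
    refine le_of_eq ?_
    ring
  obtain ⟨a, -, ha⟩ := Finset.exists_le_of_sum_le Finset.univ_nonempty h
  exact ⟨a, by exact_mod_cast ha⟩

lemma realPotential_nextSymbol_le (hB : IsPrefixTest B) (l : ℕ) (v : List (Fin k)) :
    realPotential d B x l (v ++ [nextSymbol d B x l v]) ≤ realPotential d B x l v := by
  have hk : (0 : ℝ) < k := by exact_mod_cast Fin.pos d
  have h : potential d B x l (v ++ [nextSymbol d B x l v]) ≤ potential d B x l v := by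
    obtain ⟨a, ha⟩ := exists_potential_le (d := d) (x := x) hB l v
    have hlt : (List.finRange k).findIdx (fun a =>
        decide (potential d B x l (v ++ [a]) ≤ potential d B x l v)) <
          (List.finRange k).length :=
      List.findIdx_lt_length_of_exists ⟨a, List.mem_finRange a, by simpa using ha⟩
    have := List.findIdx_getElem (w := hlt)
    rw [nextSymbol, List.getD_eq_getElem _ _ hlt]
    simpa using this
  have h' : (potential d B x l (v ++ [nextSymbol d B x l v]) : ℝ) ≤ potential d B x l v := by
    exact_mod_cast h
  rw [potential_eq hB, potential_eq hB] at h'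
  exact le_of_mul_le_mul_left h' (by positivity)

lemma condAvg_le_of_isActive (hB : IsPrefixTest B) {i n : ℕ} (hA : IsActive d B x i n)
    {v : List (Fin k)}
    (hv : v.length ≤ n.sqrt) :
    condAvg d n (fun y => if B i n x y then 1 else 0) v ≤ 1 / ((n + 1) * ((n + 2) * (n + 3))) := by
  have hk : (1 : ℝ) ≤ k := by exact_mod_cast Fin.pos d
  have h0 : ∀ y, (0 : ℝ) ≤ if B i n x y then 1 else 0 := fun y => by split_ifs <;> norm_num
  have h1 := condAvg_le d (dependsOnPrefix_test (x := x) hB i n) h0 v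
  have h2 : (testCount d B x i n n [] : ℝ) * ((n + 1) * ((n + 2) * (n + 3)) * k ^ n.sqrt) ≤
      k ^ n := by exact_mod_cast hA
  rw [testCount_eq hB i le_rfl, mul_assoc] at h2
  have h4 : condAvg d n (fun y => if B i n x y then 1 else 0) [] *
      ((n + 1) * ((n + 2) * (n + 3)) * k ^ n.sqrt) ≤ 1 := by
    refine le_of_mul_le_mul_left (h2.trans_eq (mul_one _).symm) (by positivity)
  have h5 := condAvg_nonneg d (n := n) h0 []
  rw [le_div_iff₀ (by positivity)]
  calc _ ≤ (k : ℝ) ^ v.length * condAvg d n (fun y => if B i n x y then 1 else 0) [] *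
        ((n + 1) * ((n + 2) * (n + 3))) := by gcongr
    _ ≤ (k : ℝ) ^ n.sqrt * condAvg d n (fun y => if B i n x y then 1 else 0) [] *
        ((n + 1) * ((n + 2) * (n + 3))) := by gcongr
    _ ≤ 1 := by linarith

lemma realPotential_succ_le (hB : IsPrefixTest B) (l : ℕ) {v : List (Fin k)} (hv : v.length ≤ l + 1) :
    realPotential d B x (l + 1) v ≤ realPotential d B x l v +
      ∑ n ∈ (Ico ((l + 1) ^ 2) ((l + 1 + 1) ^ 2) : Finset ℕ), 1 / (((n : ℝ) + 2) * (n + 3)) := by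
  rw [realPotential, realPotential, ← Finset.sum_range_add_sum_Ico _
    (show (l + 1) ^ 2 ≤ (l + 1 + 1) ^ 2 by gcongr; omega)]
  gcongr with n hn
  have hs : v.length ≤ n.sqrt := hv.trans (Nat.le_sqrt'.2 (Finset.mem_Ico.1 hn).1)
  calc _ ≤ ∑ i ∈ range (n + 1), 1 / (((n : ℝ) + 1) * ((n + 2) * (n + 3))) := by
        refine Finset.sum_le_sum fun i _ => ?_
        split_ifs with hA
        · exact condAvg_le_of_isActive hB hA hs
        · positivity
    _ = _ := by
        simp only [Finset.sum_const, Finset.card_range, nsmul_eq_mul]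
        push_cast
        field_simp

lemma realPotential_avoidPrefix_le (hB : IsPrefixTest B) (l : ℕ) :
    realPotential d B x l (avoidPrefix d B x l) ≤
    ∑ n ∈ range ((l + 1) ^ 2), 1 / (((n : ℝ) + 2) * (n + 3)) := by
  induction l with
  | zero =>
    simp only [realPotential, zero_add, one_pow, Finset.sum_range_one, avoidPrefix]
    split_ifs with hA
    · exact (condAvg_le_of_isActive hB hA (by simp)).trans_eq (by norm_num)
    · positivity
  | succ l ih =>
    rw [← Finset.sum_range_add_sum_Ico _
      (show (l + 1) ^ 2 ≤ (l + 1 + 1) ^ 2 by gcongr; omega)]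
    refine (realPotential_succ_le hB l (length_avoidPrefix _).le).trans ?_
    gcongr
    exact (realPotential_nextSymbol_le hB l _).trans ih

lemma realPotential_avoidPrefix_lt_one (hB : IsPrefixTest B) (l : ℕ) :
    realPotential d B x l (avoidPrefix d B x l) < 1 := by
  refine (realPotential_avoidPrefix_le hB l).trans_lt ?_
  have h : ∀ N : ℕ, ∑ n ∈ range N, 1 / (((n : ℝ) + 2) * (n + 3)) = 1 / 2 - 1 / (N + 2) :=
    fun N => by
      induction N with
      | zero => simp
      | succ N ih => rw [Finset.sum_range_succ, ih]; push_cast; field_simp; ring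
  rw [h]
  have : (0 : ℝ) ≤ 1 / (((l + 1) ^ 2 : ℕ) + 2) := by positivity
  linarith

lemma test_avoid (hB : IsPrefixTest B) {i n : ℕ} (hi : i ≤ n) (hA : IsActive d B x i n) :
    B i n x (avoid d B x) = false := by
  by_contra hne
  rw [Bool.not_eq_false] at hne
  have h0 : ∀ j y, (0 : ℝ) ≤ if B j n x y then 1 else 0 := fun j y => by split_ifs <;> norm_num
  refine (realPotential_avoidPrefix_lt_one (d := d) (x := x) hB n).not_ge ?_
  have hterm : ∀ m j, (0 : ℝ) ≤ if IsActive d B x j m then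
      condAvg d m (fun y => if B j m x y then 1 else 0) (avoidPrefix d B x n) else 0 := fun m j => by
    split_ifs
    · exact condAvg_nonneg d (fun y => by split_ifs <;> norm_num) _
    · rfl
  have h1 : condAvg d n (fun y => if B i n x y then 1 else 0) (avoidPrefix d B x n) = 1 := by
    have : (fun y => if B i n x (prepend (avoidPrefix d B x n) y) then (1 : ℝ) else 0) =
        fun _ => 1 := by
      funext y
      rw [hB i n x x (prepend (avoidPrefix d B x n) y) (avoid d B x) (fun _ _ => rfl), if_pos hne]
      intro j hj
      rw [prepend_apply_of_lt d (by rwa [length_avoidPrefix]), avoidPrefix_getD hj]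
    rw [condAvg, this, avg_const]
  rw [realPotential]
  refine le_trans ?_ (Finset.single_le_sum (f := fun n' => ∑ i ∈ range (n' + 1),
    if IsActive d B x i n' then condAvg d n' (fun y => if B i n' x y then 1 else 0)
      (avoidPrefix d B x n) else 0) (fun m _ => Finset.sum_nonneg fun j _ => hterm m j)
      (Finset.mem_range.2 (show n < (n + 1) ^ 2 by nlinarith)))
  refine le_trans ?_ (Finset.single_le_sum (fun j _ => hterm n j)
    (Finset.mem_range.2 (Nat.lt_succ_of_le hi)))
  rw [if_pos hA, h1]

lemma eventually_isActive (hB : IsPrefixTest B) {i : ℕ} {ρ : ℝ} (h0 : 0 < ρ) (h1 : ρ < 1)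
    (h : ∀ᶠ n in atTop, avg d n (fun y => if B i n x y then 1 else 0) ≤ ρ ^ n) :
    ∀ᶠ n in atTop, IsActive d B x i n := by
  have hk : (1 : ℝ) ≤ k := by exact_mod_cast Fin.pos d
  obtain ⟨r, hr0, hr1, hr⟩ : ∃ r : ℝ, 0 < r ∧ r < 1 ∧ ρ = r * r :=
    ⟨√ρ, by positivity, by rw [Real.sqrt_lt' one_pos]; simpa using h1,
      (Real.mul_self_sqrt h0.le).symm⟩
  have hs : Tendsto Nat.sqrt atTop atTop :=
    tendsto_atTop.2 fun b => (eventually_ge_atTop (b ^ 2)).mono fun n hn => Nat.le_sqrt'.2 hn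
  have e1 : ∀ᶠ s : ℕ in atTop, (k : ℝ) * r ^ s ≤ 1 := by
    have := (tendsto_pow_atTop_nhds_zero_of_lt_one hr0.le hr1).const_mul (k : ℝ)
    rw [mul_zero] at this
    exact this.eventually_le_const one_pos
  have e2 : ∀ᶠ n : ℕ in atTop, ((n : ℝ) + 1) * ((n + 2) * (n + 3)) * r ^ n ≤ 1 := by
    have t := fun j => tendsto_pow_const_mul_const_pow_of_abs_lt_one j
      (show |r| < 1 by rwa [abs_of_pos hr0])
    have := ((t 3).add (((t 2).const_mul 6).add (((t 1).const_mul 11).add ((t 0).const_mul 6))))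
    simp only [mul_zero, add_zero] at this
    filter_upwards [this.eventually_le_const one_pos] with n hn
    refine le_trans (le_of_eq ?_) hn
    ring
  filter_upwards [h, hs.eventually e1, e2] with n hn h1 h2
  have h3 : (testCount d B x i n n [] : ℝ) * ((n + 1) * ((n + 2) * (n + 3)) * k ^ n.sqrt) ≤
      k ^ n := by
    rw [testCount_eq hB i le_rfl]
    have h4 : condAvg d n (fun y => if B i n x y then 1 else 0) [] ≤ r ^ n * r ^ n := by
      rw [← mul_pow, ← hr]; exact hn
    have h5 : (k : ℝ) ^ n.sqrt * r ^ n ≤ 1 := by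
      calc _ ≤ (k : ℝ) ^ n.sqrt * r ^ (n.sqrt * n.sqrt) := by
            gcongr ?_ * ?_
            exact pow_le_pow_of_le_one hr0.le hr1.le (Nat.sqrt_le n)
        _ = (k * r ^ n.sqrt) ^ n.sqrt := by rw [mul_pow, pow_mul]
        _ ≤ 1 := pow_le_one₀ (by positivity) h1
    calc _ ≤ (k : ℝ) ^ n * (r ^ n * r ^ n) *
          ((n + 1) * ((n + 2) * (n + 3)) * k ^ n.sqrt) := by gcongr
      _ = (k : ℝ) ^ n * (((n + 1) * ((n + 2) * (n + 3)) * r ^ n) * (k ^ n.sqrt * r ^ n)) := by ring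
      _ ≤ (k : ℝ) ^ n * (1 * 1) := by gcongr
      _ = k ^ n := by ring
  exact_mod_cast h3

end Derandomization

section Primrec

variable {α : Type} [Primcodable α]

lemma primrec_list_sum : Primrec (List.sum : List ℕ → ℕ) :=
  Primrec.list_foldr (h := fun _ p => p.1 + p.2) Primrec.id (Primrec.const 0)
    (Primrec.nat_add.comp (Primrec.fst.comp Primrec.snd) (Primrec.snd.comp Primrec.snd)).to₂

lemma primrec_sum_range {f : α × ℕ → ℕ} {g : α → ℕ} (hf : Primrec f) (hg : Primrec g) :
    Primrec fun a => ∑ i ∈ range (g a), f (a, i) := by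
  refine (primrec_list_sum.comp (Primrec.list_map (Primrec.list_range.comp hg) hf.to₂)).of_eq
    fun a => ?_
  rw [Finset.sum_eq_multiset_sum, Finset.range_val, Multiset.range, Multiset.map_coe,
    Multiset.sum_coe]

lemma primrec_pow {f g : α → ℕ} (hf : Primrec f) (hg : Primrec g) :
    Primrec fun a => f a ^ g a :=
  (Primrec₂.unpaired'.1 Nat.Primrec.pow).comp hf hg

variable {k : ℕ}

lemma primrec_words : Primrec (words k) := by
  have hcons : Primrec₂ fun (p : List (List (Fin k)) × Fin k) (u : List (Fin k)) => p.2 :: u :=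
    (Primrec.list_cons.comp (Primrec.snd.comp Primrec.fst) Primrec.snd).to₂
  have hmap : Primrec₂ fun (W : List (List (Fin k))) (a : Fin k) => W.map fun u => a :: u :=
    (Primrec.list_map Primrec.fst hcons).to₂
  have hstep : Primrec fun W : List (List (Fin k)) =>
      (List.finRange k).flatMap fun a => W.map fun u => a :: u :=
    Primrec.list_flatMap (Primrec.const _) hmap
  refine (Primrec.nat_rec₁ [[]] (hstep.comp₂ Primrec₂.right)).of_eq fun n => ?_
  induction n with
  | zero => rfl
  | succ n ih => simp only [words, ← ih]

lemma primrec_tape (d : Fin k) : Primrec₂ (tape d) := Primrec.list_getD d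

end Primrec

/-- Codes of tests: initial state, transition table, tested state and symbol, tolerance. -/
abbrev TestCode (k : ℕ) := ℕ × List (Bool × List ℕ) × ℕ × Fin k × ℕ

/-- The two-tape reader on `ℕ` given by a table. -/
def TwoTape.ofTable (k : ℕ) (T : List (Bool × List ℕ)) : TwoTape k ℕ where
  τ q := (T.getD q (false, [])).1
  δ q a := (T.getD q (false, [])).2.getD a 0

/-- The test with number `i` at length `n`. -/
def codedTest {k : ℕ} (d : Fin k) (i n : ℕ) (x y : ℕ → Fin k) : Bool :=
  let c : TestCode k := (Encodable.decode i).getD (0, [], 0, d, 0)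
  decide ((TwoTape.ofTable k c.2.1).Overfull x y c.1 c.2.2.1 c.2.2.2.1 c.2.2.2.2 n)

lemma codedTest_congr {k : ℕ} (d : Fin k) (i n : ℕ) (x x' y y' : ℕ → Fin k)
    (hx : ∀ j < n, x j = x' j) (hy : ∀ j < n, y j = y' j) :
    codedTest d i n x y = codedTest d i n x' y' := by
  simp only [codedTest, TwoTape.overfull_congr _ _ _ _ _ hx hy]

section Primrec

variable {k : ℕ} {α : Type} [Primcodable α] (d : Fin k)

lemma primrec_sym {T : α → List (Bool × List ℕ)} {X U : α → List (Fin k)} {c : α → ℕ × ℕ × ℕ}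
    (hT : Primrec T) (hX : Primrec X) (hU : Primrec U) (hc : Primrec c) :
    Primrec fun a => (TwoTape.ofTable k (T a)).sym (tape d (X a)) (tape d (U a)) (c a) := by
  unfold TwoTape.sym
  refine Primrec.ite ?_ ((primrec_tape d).comp hX (Primrec.fst.comp (Primrec.snd.comp hc)))
    ((primrec_tape d).comp hU (Primrec.snd.comp (Primrec.snd.comp hc)))
  exact Primrec.eq.comp (Primrec.fst.comp ((Primrec.list_getD _).comp hT (Primrec.fst.comp hc)))
    (Primrec.const true)

lemma primrec_step {T : α → List (Bool × List ℕ)} {X U : α → List (Fin k)} {c : α → ℕ × ℕ × ℕ}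
    (hT : Primrec T) (hX : Primrec X) (hU : Primrec U) (hc : Primrec c) :
    Primrec fun a => (TwoTape.ofTable k (T a)).step (tape d (X a)) (tape d (U a)) (c a) := by
  have hrow := (Primrec.list_getD (false, ([] : List ℕ))).comp hT (Primrec.fst.comp hc)
  have hs := primrec_sym d hT hX hU hc
  have hδ := (Primrec.list_getD 0).comp (Primrec.snd.comp hrow) (Primrec.fin_val.comp hs)
  have h1 := Primrec.fst.comp (Primrec.snd.comp hc)
  have h2 := Primrec.snd.comp (Primrec.snd.comp hc)
  refine (Primrec.ite (Primrec.eq.comp (Primrec.fst.comp hrow) (Primrec.const true))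
    (Primrec.pair hδ (Primrec.pair (Primrec.succ.comp h1) h2))
    (Primrec.pair hδ (Primrec.pair h1 (Primrec.succ.comp h2)))).of_eq fun a => ?_
  unfold TwoTape.step TwoTape.sym TwoTape.ofTable
  dsimp only
  split_ifs <;> rfl

lemma primrec_run {T : α → List (Bool × List ℕ)} {X U : α → List (Fin k)} {c : α → ℕ × ℕ × ℕ}
    {n : α → ℕ} (hT : Primrec T) (hX : Primrec X) (hU : Primrec U) (hc : Primrec c)
    (hn : Primrec n) :
    Primrec fun a => (TwoTape.ofTable k (T a)).run (tape d (X a)) (tape d (U a)) (c a) (n a) :=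
  Primrec.nat_iterate hn hc (primrec_step d (hT.comp Primrec.fst) (hX.comp Primrec.fst)
    (hU.comp Primrec.fst) Primrec.snd).to₂

lemma primrec_codedTest {i n : α → ℕ} {X U : α → List (Fin k)} (hi : Primrec i) (hn : Primrec n)
    (hX : Primrec X) (hU : Primrec U) :
    Primrec fun a => codedTest d (i a) (n a) (tape d (X a)) (tape d (U a)) := by
  have hc : Primrec fun a =>
      (Encodable.decode (α := TestCode k) (i a)).getD (0, [], 0, d, 0) :=
    Primrec.option_getD.comp (Primrec.decode.comp hi) (Primrec.const _)
  have hT := Primrec.fst.comp (Primrec.snd.comp hc)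
  have hq := Primrec.fst.comp (Primrec.snd.comp (Primrec.snd.comp hc))
  have ha := Primrec.fst.comp (Primrec.snd.comp (Primrec.snd.comp (Primrec.snd.comp hc)))
  have he := Primrec.snd.comp (Primrec.snd.comp (Primrec.snd.comp (Primrec.snd.comp hc)))
  have hrun := primrec_run d (hT.comp Primrec.fst) (hX.comp Primrec.fst) (hU.comp Primrec.fst)
    (((Primrec.fst.comp hc).pair (Primrec.const (0, 0))).comp Primrec.fst)
    (Primrec.snd (α := α) (β := ℕ))
  have hsym := primrec_sym d (hT.comp Primrec.fst) (hX.comp Primrec.fst) (hU.comp Primrec.fst) hrun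
  have hst := Primrec.eq.comp (Primrec.fst.comp hrun) (hq.comp Primrec.fst)
  have hv := primrec_sum_range
    (Primrec.ite hst (Primrec.const 1) (Primrec.const 0)) hn
  have hh := primrec_sum_range
    (Primrec.ite (hst.and (Primrec.eq.comp hsym (ha.comp Primrec.fst)))
      (Primrec.const 1) (Primrec.const 0)) hn
  exact (Primrec.nat_lt.comp (Primrec.nat_add.comp (Primrec.nat_mul.comp he hv) hn)
    (Primrec.nat_mul.comp he (Primrec.nat_mul.comp (Primrec.const k) hh))).decide

lemma primrec_testCount {i n m : α → ℕ} {X v : α → List (Fin k)} (hi : Primrec i)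
    (hn : Primrec n) (hm : Primrec m) (hX : Primrec X) (hv : Primrec v) :
    Primrec fun a => testCount d (codedTest d) (tape d (X a)) (i a) (n a) (m a) (v a) := by
  unfold testCount
  refine primrec_list_sum.comp (Primrec.list_map (primrec_words.comp hm) ?_)
  refine (Primrec.ite (Primrec.eq.comp (primrec_codedTest d (hi.comp Primrec.fst)
    (hn.comp Primrec.fst) (hX.comp Primrec.fst) (Primrec.list_append.comp (hv.comp Primrec.fst)
      Primrec.snd)) (Primrec.const true)) (Primrec.const 1) (Primrec.const 0)).to₂

lemma primrec_isActive {i n : α → ℕ} {X : α → List (Fin k)} (hi : Primrec i)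
    (hn : Primrec n) (hX : Primrec X) :
    PrimrecPred fun a => IsActive d (codedTest d) (tape d (X a)) (i a) (n a) := by
  have hadd := fun j => Primrec.nat_add.comp hn (Primrec.const j)
  exact Primrec.nat_le.comp (Primrec.nat_mul.comp
    (primrec_testCount d hi hn hn hX (Primrec.const []))
    (Primrec.nat_mul.comp (Primrec.nat_mul.comp (hadd 1) (Primrec.nat_mul.comp (hadd 2) (hadd 3)))
      (primrec_pow (Primrec.const k) (Primrec.nat_sqrt.comp hn)))) (primrec_pow (Primrec.const k) hn)

lemma primrec_potential {l : α → ℕ} {X v : α → List (Fin k)} (hl : Primrec l)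
    (hX : Primrec X) (hv : Primrec v) :
    Primrec fun a => potential d (codedTest d) (tape d (X a)) (l a) (v a) := by
  have hm := primrec_pow (Primrec.succ.comp hl) (Primrec.const 2)
  refine primrec_sum_range (primrec_sum_range
    (Primrec.ite (primrec_isActive d Primrec.snd (Primrec.snd.comp Primrec.fst)
      (hX.comp (Primrec.fst.comp Primrec.fst)))
      (primrec_testCount d Primrec.snd (Primrec.snd.comp Primrec.fst)
        (hm.comp (Primrec.fst.comp Primrec.fst)) (hX.comp (Primrec.fst.comp Primrec.fst))
        (hv.comp (Primrec.fst.comp Primrec.fst))) (Primrec.const 0))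
      (Primrec.succ.comp Primrec.snd)) hm

lemma primrec_nextSymbol {l : α → ℕ} {X v : α → List (Fin k)} (hl : Primrec l)
    (hX : Primrec X) (hv : Primrec v) :
    Primrec fun a => nextSymbol d (codedTest d) (tape d (X a)) (l a) (v a) := by
  refine (Primrec.list_getD d).comp (Primrec.const _) (Primrec.list_findIdx (Primrec.const _) ?_)
  exact (Primrec.nat_le.comp (primrec_potential d (hl.comp Primrec.fst) (hX.comp Primrec.fst)
    (Primrec.list_append.comp (hv.comp Primrec.fst)
      (Primrec.list_cons.comp Primrec.snd (Primrec.const []))))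
    (primrec_potential d (hl.comp Primrec.fst) (hX.comp Primrec.fst) (hv.comp Primrec.fst))).decide

end Primrec

section Computable

variable {k : ℕ} (d : Fin k)

lemma nextSymbol_tape_wpre (x : ℕ → Fin k) (l : ℕ) (v : List (Fin k)) :
    nextSymbol d (codedTest d) (tape d (wpre x ((l + 1) ^ 2))) l v =
      nextSymbol d (codedTest d) x l v := by
  have h : ∀ i n m u, n < (l + 1) ^ 2 →
      testCount d (codedTest d) (tape d (wpre x ((l + 1) ^ 2))) i n m u =
        testCount d (codedTest d) x i n m u := fun i n m u hn => by
    have : ∀ y, codedTest d i n (tape d (wpre x ((l + 1) ^ 2))) y = codedTest d i n x y := fun y =>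
      codedTest_congr d i n _ _ _ _ (fun j hj => tape_wpre d x (hj.trans hn)) fun _ _ => rfl
    simp only [testCount, this]
  have hp : ∀ u, potential d (codedTest d) (tape d (wpre x ((l + 1) ^ 2))) l u =
      potential d (codedTest d) x l u := fun u => by
    refine Finset.sum_congr rfl fun n hn => Finset.sum_congr rfl fun i _ => ?_
    have hn := Finset.mem_range.1 hn
    simp only [IsActive, h i n _ _ hn]
  simp only [nextSymbol, hp]

lemma computable_wpre {x : ℕ → Fin k} (hx : Computable x) : Computable (wpre x) := by
  refine (Computable.nat_rec (f := id) (g := fun _ => ([] : List (Fin k)))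
    (h := fun _ p => p.2 ++ [x p.1]) Computable.id (Computable.const [])
    (Computable.list_concat.comp (Computable.snd.comp Computable.snd)
      (hx.comp (Computable.fst.comp Computable.snd))).to₂).of_eq fun n => ?_
  induction n with
  | zero => rfl
  | succ n ih =>
    simp only [id_eq] at ih ⊢
    rw [ih, wpre, wpre, List.ofFn_succ_last]
    rfl

lemma computable_avoid {x : ℕ → Fin k} (hx : Computable x) :
    Computable (avoid d (codedTest d) x) := by
  have hnext : Computable₂ fun (_ : ℕ) (p : ℕ × List (Fin k)) =>
      p.2 ++ [nextSymbol d (codedTest d) (tape d (wpre x ((p.1 + 1) ^ 2))) p.1 p.2] := by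
    have h : Computable fun p : ℕ × List (Fin k) × List (Fin k) =>
        nextSymbol d (codedTest d) (tape d p.2.1) p.1 p.2.2 :=
      (primrec_nextSymbol d Primrec.fst (Primrec.fst.comp Primrec.snd)
        (Primrec.snd.comp Primrec.snd)).to_comp
    have hp : Computable fun p : ℕ × ℕ × List (Fin k) => (p.2.1 + 1) ^ 2 :=
      (primrec_pow (Primrec.succ.comp (Primrec.fst.comp Primrec.snd)) (Primrec.const 2)).to_comp
    have hq : Computable fun p : ℕ × ℕ × List (Fin k) =>
        (p.2.1, wpre x ((p.2.1 + 1) ^ 2), p.2.2) :=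
      (Computable.fst.comp Computable.snd).pair
        (((computable_wpre hx).comp hp).pair (Computable.snd.comp Computable.snd))
    have hs := h.comp hq
    exact Computable.list_concat.comp (Computable.snd.comp Computable.snd) hs
  have hpre : Computable (avoidPrefix d (codedTest d) x) := by
    refine (Computable.nat_rec (f := id) (g := fun _ => ([] : List (Fin k)))
      Computable.id (Computable.const []) hnext).of_eq fun n => ?_
    induction n with
    | zero => rfl
    | succ n ih =>
      simp only [id_eq, nextSymbol_tape_wpre] at ih ⊢
      rw [ih, avoidPrefix]
  exact (Primrec.list_getD d).to_comp.comp (hpre.comp Computable.succ) Computable.id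

end Computable

section Coding

variable {k : ℕ} {Q : Type} [Fintype Q] [DecidableEq Q]

lemma exists_codedTest_eq (d : Fin k) (A : TwoTape k Q) (q₀ q : Q) (a : Fin k) (e : ℕ) :
    ∃ i, ∀ n x y, codedTest d i n x y = decide (A.Overfull x y q₀ q a e n) := by
  let ε := Fintype.equivFin Q
  let f : Q → ℕ := fun q => ε q
  have hf : Function.Injective f := Fin.val_injective.comp ε.injective
  let T : List (Bool × List ℕ) := List.ofFn fun i =>
    (A.τ (ε.symm i), List.ofFn fun a => f (A.δ (ε.symm i) a))
  have hT : ∀ q, T.getD (f q) (false, []) = (A.τ q, List.ofFn fun a => f (A.δ q a)) := fun q => by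
    simp [T, f]
  have hτ : ∀ q, (TwoTape.ofTable k T).τ (f q) = A.τ q := fun q => by
    simp only [TwoTape.ofTable, hT]
  have hδ : ∀ q a, (TwoTape.ofTable k T).δ (f q) a = f (A.δ q a) := fun q a => by
    simp only [TwoTape.ofTable, hT]
    simp
  refine ⟨Encodable.encode (α := TestCode k) (f q₀, T, f q, a, e), fun n x y => ?_⟩
  simp only [codedTest, Encodable.encodek, Option.getD_some]
  exact decide_eq_decide.2 (A.overfull_map x y _ hf hτ hδ q₀ q a e n)

lemma eventually_not_overfull_avoid (d : Fin k) {x : ℕ → Fin k} (hx : IsNormal x)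
    (A : TwoTape k Q) (q₀ q : Q) (a : Fin k) {e : ℕ} (he : 0 < e) :
    ∀ᶠ n in atTop, ¬ A.Overfull x (avoid d (codedTest d) x) q₀ q a e n := by
  obtain ⟨i, hi⟩ := exists_codedTest_eq d A q₀ q a e
  obtain ⟨ρ, h0, h1, h⟩ := A.exists_eventually_avg_overfull_le d hx q₀ q a he
  have hact := eventually_isActive (d := d) (x := x) (codedTest_congr d) (i := i) h0 h1 (by
    simpa only [hi, decide_eq_true_eq] using h)
  filter_upwards [hact, eventually_ge_atTop i] with n hn hin
  have := test_avoid (codedTest_congr d) hin hn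
  rw [hi] at this
  simpa using this

end Coding

lemma tendsto_of_tendsto_sum {ι : Type*} [Fintype ι] {f : ι → ℕ → ℝ} {L : ℝ}
    (hs : Tendsto (fun n => ∑ i, f i n) atTop (nhds (Fintype.card ι * L)))
    (hu : ∀ i, ∀ ε > 0, ∀ᶠ n in atTop, f i n ≤ L + ε) (i : ι) :
    Tendsto (f i) atTop (nhds L) := by
  have hlow : ∀ ε > 0, ∀ᶠ n in atTop, L - ε ≤ f i n := fun ε hε => by
    set δ := ε / (Fintype.card ι + 1) with hδ
    have hδ0 : 0 < δ := by positivity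
    have hε' : ε = Fintype.card ι * δ + δ := by rw [hδ]; field_simp
    filter_upwards [hs.eventually_const_le (sub_lt_self _ hδ0), eventually_all.2 fun j => hu j δ hδ0]
      with n h1 h2
    have h3 := Finset.single_le_sum (f := fun j => L + δ - f j n)
      (fun j _ => sub_nonneg.2 (h2 j)) (Finset.mem_univ i)
    simp only [Finset.sum_sub_distrib, Finset.sum_const, Finset.card_univ, nsmul_eq_mul] at h3
    nlinarith
  refine tendsto_order.2 ⟨fun a ha => ?_, fun a ha => ?_⟩
  · filter_upwards [hlow ((L - a) / 2) (by linarith)] with n hn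
    linarith
  · filter_upwards [hu i ((a - L) / 2) (by linarith)] with n hn
    linarith

namespace TwoTape

variable {k : ℕ} {Q : Type} (A : TwoTape k Q)

/-- The reader `A` with a memory of the last `m` symbols read. -/
def withBuffer (m : ℕ) : TwoTape k (Q × (Fin m → Fin k)) where
  τ p := A.τ p.1
  δ p a := (A.δ p.1 a, fun j => if h : j + 1 < m then p.2 ⟨j + 1, h⟩ else a)

/-- The sequence of symbols read. -/
def output (x y : ℕ → Fin k) (q₀ : Q) (n : ℕ) : Fin k := A.sym x y (A.run x y (q₀, 0, 0) n)

variable (x y : ℕ → Fin k) (q₀ : Q)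

lemma withBuffer_sym {m : ℕ} (v : Fin m → Fin k) (n : ℕ) :
    (A.withBuffer m).sym x y ((A.withBuffer m).run x y ((q₀, v), 0, 0) n) =
      A.output x y q₀ n := by
  rw [output, ← (A.withBuffer m).sym_map x y A Prod.fst (fun _ => rfl),
    ← (A.withBuffer m).run_map x y A Prod.fst (fun _ => rfl) (fun _ _ => rfl)]

lemma withBuffer_run_apply {m : ℕ} (v : Fin m → Fin k) (n : ℕ) (j : Fin m) (h : m ≤ n + j) :
    ((A.withBuffer m).run x y ((q₀, v), 0, 0) n).1.2 j = A.output x y q₀ (n + j - m) := by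
  induction n generalizing j with
  | zero => omega
  | succ n ih =>
    rw [run_succ, step_fst, withBuffer_sym]
    simp only [withBuffer]
    split_ifs with hj
    · exact (ih ⟨j + 1, hj⟩ (by simp only; omega)).trans (by congr 1; simp only; omega)
    · congr 1
      omega

lemma ofFn_withBuffer_run {m : ℕ} (v : Fin m → Fin k) (t : ℕ) :
    List.ofFn ((A.withBuffer m).run x y ((q₀, v), 0, 0) (m + t)).1.2 =
      factor (A.output x y q₀) t m := by
  rw [factor]
  congr 1
  funext j
  rw [withBuffer_run_apply _ _ _ _ _ _ _ (by omega)]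
  congr 1
  omega

end TwoTape

section Count

variable {k : ℕ}

/-- The number of occurrences of `w` in `z` starting before position `n`. -/
def factorCount (z : ℕ → Fin k) (w : List (Fin k)) (n : ℕ) : ℕ :=
  ∑ t ∈ range n, if factor z t w.length = w then 1 else 0

lemma factor_append_iff (z : ℕ → Fin k) (t : ℕ) (w : List (Fin k)) (a : Fin k) :
    factor z t (w ++ [a]).length = w ++ [a] ↔ factor z t w.length = w ∧ z (t + w.length) = a := by
  rw [List.length_append, List.length_singleton, factor_add,
    show factor z (t + w.length) 1 = [z (t + w.length)] by simp [factor],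
    List.append_singleton_inj]

lemma sum_factorCount_append (z : ℕ → Fin k) (w : List (Fin k)) (n : ℕ) :
    ∑ a, factorCount z (w ++ [a]) n = factorCount z w n := by
  simp only [factorCount]
  rw [Finset.sum_comm]
  refine Finset.sum_congr rfl fun t _ => ?_
  simp only [factor_append_iff, ite_and]
  split_ifs <;> simp

lemma occ_wpre_le_factorCount (z : ℕ → Fin k) (w : List (Fin k)) (hw : w ≠ []) (n : ℕ) :
    occ (wpre z n) w ≤ factorCount z w n := by
  have := List.length_pos_iff.2 hw
  rw [occ_wpre, factorCount, ← Finset.card_filter]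
  exact Finset.card_le_card (Finset.filter_subset_filter _
    (Finset.range_subset_range.2 (by omega)))

lemma factorCount_le_occ_wpre (z : ℕ → Fin k) (w : List (Fin k)) (n : ℕ) :
    factorCount z w n ≤ occ (wpre z n) w + w.length := by
  rw [occ_wpre, factorCount, Finset.card_filter]
  have h : n ≤ (n + 1 - w.length) + w.length := by omega
  refine (Finset.sum_le_sum_of_subset (Finset.range_subset_range.2 h)).trans ?_
  rw [Finset.sum_range_add]
  gcongr
  refine (Finset.sum_le_card_nsmul _ _ 1 fun t _ => ?_).trans (by simp)
  split_ifs <;> simp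

lemma isNormal_of_tendsto_factorCount {z : ℕ → Fin k}
    (h : ∀ w, Tendsto (fun n => (factorCount z w n : ℝ) / n) atTop
      (nhds (1 / (k : ℝ) ^ w.length))) : IsNormal z := fun w hw => by
  have h0 : Tendsto (fun n : ℕ => (w.length : ℝ) / n) atTop (nhds 0) :=
    tendsto_const_div_atTop_nhds_zero_nat _
  have h1 := (h w).sub h0
  rw [sub_zero] at h1
  refine tendsto_of_tendsto_of_tendsto_of_le_of_le h1 (h w) (fun n => ?_) fun n => ?_
  · have : (factorCount z w n : ℝ) ≤ occ (wpre z n) w + w.length := by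
      exact_mod_cast factorCount_le_occ_wpre z w n
    rw [← sub_div]
    exact div_le_div_of_nonneg_right (by linarith) n.cast_nonneg
  · exact div_le_div_of_nonneg_right
      (Nat.cast_le.2 (occ_wpre_le_factorCount z w hw n)) n.cast_nonneg

end Count

namespace TwoTape

variable {k : ℕ} {Q : Type} [Fintype Q] [DecidableEq Q] (A : TwoTape k Q) (x y : ℕ → Fin k) (q₀ : Q)

lemma factorCount_append_le {m : ℕ} (v : Fin m → Fin k) (a : Fin k) (n : ℕ) :
    factorCount (A.output x y q₀) (List.ofFn v ++ [a]) n ≤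
      ∑ q, (A.withBuffer m).hits x y ((q₀, v), 0, 0) (q, v) a (m + n) := by
  simp only [hits, factorCount, factor_append_iff, withBuffer_sym]
  rw [Finset.sum_comm, Finset.sum_range_add]
  refine le_add_left (Finset.sum_le_sum fun t _ => ?_)
  simp only [List.length_ofFn, ← ofFn_withBuffer_run A x y q₀ v, List.ofFn_inj]
  split_ifs with h
  · refine le_trans ?_ (Finset.single_le_sum (fun _ _ => Nat.zero_le _)
      (Finset.mem_univ ((A.withBuffer m).run x y ((q₀, v), 0, 0) (m + t)).1.1))
    rw [if_pos ⟨Prod.ext rfl h.1, by rw [add_comm]; exact h.2⟩]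
  · exact Nat.zero_le _

lemma sum_visits_le {m : ℕ} (v : Fin m → Fin k) (n : ℕ) :
    ∑ q, (A.withBuffer m).visits x y ((q₀, v), 0, 0) (q, v) (m + n) ≤
      m + factorCount (A.output x y q₀) (List.ofFn v) n := by
  have hite : ∀ p : Q × (Fin m → Fin k), ∑ q, (if p = (q, v) then 1 else 0) =
      if p.2 = v then 1 else 0 := fun p => by
    simp only [Prod.ext_iff, ite_and, Finset.sum_ite_eq, Finset.mem_univ, if_true]
  simp only [visits, factorCount]
  rw [Finset.sum_comm, Finset.sum_range_add]
  simp only [hite]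
  gcongr with t
  · refine (Finset.sum_le_card_nsmul _ _ 1 fun t _ => ?_).trans (by simp)
    split_ifs <;> simp
  · simp only [List.length_ofFn, ← ofFn_withBuffer_run A x y q₀ v, List.ofFn_inj]
    rfl

variable {A x y q₀}

theorem isNormal_output (H : ∀ m (p₀ p : Q × (Fin m → Fin k)) a e, 0 < e →
    ∀ᶠ n in atTop, ¬ (A.withBuffer m).Overfull x y p₀ p a e n) :
    IsNormal (A.output x y q₀) := by
  refine isNormal_of_tendsto_factorCount fun w => ?_
  set z := A.output x y q₀ with hz
  induction w using List.reverseRecOn with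
  | nil =>
    refine (tendsto_congr' ?_).2 (tendsto_const_nhds (x := (1 : ℝ) / k ^ 0))
    filter_upwards [eventually_gt_atTop 0] with n hn
    have : (n : ℝ) ≠ 0 := by exact_mod_cast hn.ne'
    simp [factorCount, factor, this]
  | append_singleton w a ih =>
    have hk : (0 : ℝ) < k := by exact_mod_cast Fin.pos a
    refine tendsto_of_tendsto_sum (f := fun a n => (factorCount z (w ++ [a]) n : ℝ) / n) ?_
      (fun b ε hε => ?_) a
    · have h1 : (Fintype.card (Fin k) : ℝ) * (1 / k ^ (w ++ [a]).length) = 1 / k ^ w.length := by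
        rw [Fintype.card_fin, List.length_append, List.length_singleton, pow_succ]
        field_simp
      rw [h1]
      refine ih.congr fun n => ?_
      rw [← Finset.sum_div, ← sum_factorCount_append, Nat.cast_sum]
    · obtain ⟨m, v, hm, hv⟩ : ∃ (m : ℕ) (v : Fin m → Fin k), w.length = m ∧ List.ofFn v = w :=
        ⟨_, w.get, rfl, List.ofFn_get w⟩
      rw [hm] at ih
      obtain ⟨e, he⟩ := exists_nat_gt ((Fintype.card Q : ℝ) / (k * ε / 3))
      have he0 : 0 < (e : ℝ) := lt_of_le_of_lt (by positivity) he
      rw [div_lt_iff₀ (by positivity)] at he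
      have hev := (tendsto_add_atTop_nat m).eventually (eventually_all.2 fun q : Q =>
        H m (q₀, v) (q, v) b e (by exact_mod_cast he0))
      have hm0 : Tendsto (fun n : ℕ => (m + Fintype.card Q * m / e : ℝ) / n) atTop (nhds 0) :=
        tendsto_const_div_atTop_nhds_zero_nat _
      filter_upwards [hev, hm0.eventually_le_const (show 0 < k * ε / 3 by positivity),
        ih.eventually_le_const (lt_add_of_pos_right _ (show 0 < k * ε / 3 by positivity)),
        eventually_gt_atTop 0] with n hn h1 h2 hn0
      have hn0' : (0 : ℝ) < n := by exact_mod_cast hn0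
      simp only [Overfull, not_lt, add_comm n m] at hn
      have h3 := Finset.sum_le_sum fun q (_ : q ∈ (Finset.univ : Finset Q)) => hn q
      rw [Finset.sum_add_distrib, ← Finset.mul_sum, ← Finset.mul_sum, ← Finset.mul_sum,
        Finset.sum_const, Finset.card_univ, smul_eq_mul] at h3
      have h4 := A.factorCount_append_le x y q₀ v b n
      have h5 := A.sum_visits_le x y q₀ v n
      rw [hv, ← hz] at h4 h5
      have h6 : e * (k * factorCount z (w ++ [b]) n) ≤
          e * (m + factorCount z w n) + Fintype.card Q * (m + n) :=
        (by gcongr : e * (k * factorCount z (w ++ [b]) n) ≤ _).trans (h3.trans (by gcongr))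
      have h7 : (e : ℝ) * (k * factorCount z (w ++ [b]) n) ≤
          e * (m + factorCount z w n) + Fintype.card Q * (m + n) := by exact_mod_cast h6
      rw [div_le_iff₀ hn0'] at h1 h2 ⊢
      have h8 : (e : ℝ) * (k * factorCount z (w ++ [b]) n) ≤
          e * (((1 : ℝ) / k ^ m + k * ε / 3) * n + k * ε / 3 * n + k * ε / 3 * n) := by
        have h9 : (e : ℝ) * (m + Fintype.card Q * m / e) ≤ e * (k * ε / 3 * n) := by gcongr
        rw [mul_add, mul_div_cancel₀ _ he0.ne'] at h9
        nlinarith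
      have h10 := le_of_mul_le_mul_left h8 he0
      refine le_of_mul_le_mul_left (h10.trans_eq ?_) hk
      rw [List.length_append, List.length_singleton, hm, pow_succ]
      field_simp
      ring

end TwoTape

lemma Shuffler.isNormal_out {k : ℕ} (d : Fin k) {x : ℕ → Fin k} (hx : IsNormal x)
    (S : Shuffler k) : IsNormal (S.out x (avoid d (codedTest d) x)) := by
  set y := avoid d (codedTest d) x with hy
  let A : TwoTape k (Fin S.n) := ⟨S.τ, S.δ⟩
  have hconf : ∀ n, S.conf x y n = A.run x y (S.q0, 0, 0) n := fun n => by
    induction n with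
    | zero => rfl
    | succ n ih =>
      rw [TwoTape.run_succ, ← ih]
      rfl
  have hout : S.out x y = A.output x y S.q0 := by
    funext n
    rw [TwoTape.output, ← hconf]
    rfl
  rw [hout]
  exact TwoTape.isNormal_output fun m p₀ p a e he =>
    eventually_not_overfull_avoid d hx (A.withBuffer m) p₀ p a he

/-- for every computable normal `x` there is a computable normal
companion `y` all of whose shuffles with `x` are normal. -/
theorem stmt_1 (k : ℕ) (hk : 2 ≤ k) (x : ℕ → Fin k)
    (hxc : Computable x) (hxn : IsNormal x) :
    ∃ y : ℕ → Fin k, Computable y ∧ IsNormal y ∧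
      ∀ S : Shuffler k, IsNormal (S.out x y) := by
  let d : Fin k := ⟨0, by omega⟩
  refine ⟨avoid d (codedTest d) x, computable_avoid d hxc, ?_, Shuffler.isNormal_out d hxn⟩
  let S : Shuffler k := ⟨1, 0, fun _ _ => 0, fun _ => false⟩
  have hconf : ∀ y n, S.conf x y n = (0, 0, n) := fun y n => by
    induction n with
    | zero => rfl
    | succ n ih => simp [Shuffler.conf, ih, S]
  have hout : ∀ y, S.out x y = y := fun y => by
    funext n
    simp [Shuffler.out, hconf, S]
  exact hout (avoid d (codedTest d) x) ▸ Shuffler.isNormal_out d hxn S
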